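/- Let d ≥ 1 and let (α,β) be a dual admissible pair, i.e. (α',β') is admissible where α',β' are the Hölder conjugates. There exists a constant C > 0 such that for every Schwartz function F : ℝ × ℝ^d → ℂ, ‖ ∫_ℝ e^{-isΔ}F(s,·) ds ‖_{L²(ℝ^d)} ≤ C ‖F‖_{L^α_t L^β_x(ℝ×ℝ^d)}, where the s-integral is a Bochner integral in L²(ℝ^d) and ‖F‖_{L^α_t L^β_x} = ( ∫_ℝ ‖F(s,·)‖_{L^β(ℝ^d)}^α ds )^{1/α}. -/

import Mathlib

open MeasureTheory Complex
open scoped ENNReal NNReal FourierTransform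

noncomputable section

/-- The free Schrödinger propagator `e^{itΔ}`:
`(e^{itΔ}φ)(x) = (4πit)^{-d/2} ∫ e^{i|x-y|²/(4t)} φ(y) dy`. -/
def schrod (d : ℕ) (t : ℝ) (φ : EuclideanSpace ℝ (Fin d) → ℂ)
    (x : EuclideanSpace ℝ (Fin d)) : ℂ :=
  (((4 * Real.pi * t : ℝ) : ℂ) * Complex.I) ^ (-(d : ℂ) / 2) *
    ∫ y : EuclideanSpace ℝ (Fin d),
      Complex.exp (Complex.I * ((‖x - y‖ : ℝ) : ℂ) ^ 2 / ((4 * t : ℝ) : ℂ)) * φ y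

/-- `(q,r)` is a Schrödinger-admissible pair in dimension `d`:
`2 ≤ q, r ≤ ∞`, `2/q + d/r = d/2`, and `(d,q,r) ≠ (2,2,∞)`. -/
def IsAdmissible (d : ℕ) (q r : ℝ≥0∞) : Prop :=
  2 ≤ q ∧ 2 ≤ r ∧ 2 / q + (d : ℝ≥0∞) / r = (d : ℝ≥0∞) / 2 ∧ ¬(d = 2 ∧ q = 2 ∧ r = ∞)

/-- The mixed (time) norm `( ∫_ℝ g(t)^q dt )^{1/q}`, with the essential supremum when
`q = ∞`. -/
def mixedLNorm (q : ℝ≥0∞) (g : ℝ → ℝ≥0∞) : ℝ≥0∞ :=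
  if q = ∞ then essSup g (volume : Measure ℝ)
  else (∫⁻ t : ℝ, g t ^ q.toReal) ^ (1 / q.toReal)

open scoped SchwartzMap

section FourierPart

variable {V : Type*} [NormedAddCommGroup V] [InnerProductSpace ℝ V] [FiniteDimensional ℝ V]
  [MeasurableSpace V] [BorelSpace V]

lemma ft_continuous {f : V → ℂ} (hf : Integrable f) : Continuous (𝓕 f) := by
  apply VectorFourier.fourierIntegral_continuous Real.continuous_fourierChar
    (by exact continuous_inner) hf

lemma ft_norm_le (f : V → ℂ) (ξ : V) : ‖𝓕 f ξ‖ ≤ ∫ x, ‖f x‖ :=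
  VectorFourier.norm_fourierIntegral_le_integral_norm _ _ _ _ _

/-- Gaussian regularised inverse Fourier transform. -/
lemma gauss_inv {b : ℂ} (hb : 0 < b.re) {f : V → ℂ} (hf : Integrable f) (x : V) :
    ∫ ξ, cexp (-b * (‖ξ‖ : ℂ) ^ 2 + 2 * Real.pi * I * (inner ℝ x ξ : ℝ)) * 𝓕 f ξ =
      ∫ y, ((Real.pi / b) ^ ((Module.finrank ℝ V : ℂ) / 2) *
        cexp (-(Real.pi : ℂ) ^ 2 * (‖x - y‖ : ℂ) ^ 2 / b)) * f y := by
  have h1 := VectorFourier.integral_fourierIntegral_smul_eq_flip (L := innerₗ V) (μ := volume)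
    (ν := volume) (e := Real.fourierChar)
    (f := fun v : V => cexp (-b * (‖v‖ : ℂ) ^ 2 + 2 * Real.pi * I * (inner ℝ x v : ℝ))) (g := f)
    Real.continuous_fourierChar (by exact continuous_inner)
    (GaussianFourier.integrable_cexp_neg_mul_sq_norm_add hb _ x) hf
  rw [flip_innerₗ] at h1
  simp only [smul_eq_mul] at h1
  refine h1.symm.trans ?_
  congr 1
  ext y
  congr 1
  exact fourier_gaussian_innerProductSpace' hb x y

lemma exp_norm_le_one {b : ℂ} (hb : 0 < b.re) (r : ℝ) :
    ‖cexp (-(Real.pi : ℂ) ^ 2 * (r : ℂ) ^ 2 / b)‖ ≤ 1 := by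
  rw [Complex.norm_exp]
  apply Real.exp_le_one_iff.2
  have : (-(Real.pi : ℂ) ^ 2 * (r : ℂ) ^ 2 / b) = ((-(Real.pi ^ 2 * r ^ 2) : ℝ) : ℂ) * b⁻¹ := by
    push_cast; ring
  rw [this, Complex.re_ofReal_mul, Complex.inv_re]
  have : 0 ≤ b.re / normSq b := div_nonneg hb.le (normSq_nonneg _)
  nlinarith [mul_nonneg (mul_nonneg (sq_nonneg Real.pi) (sq_nonneg r)) this]

/-- Gaussian regularised pairing. -/
lemma gauss_pair {b : ℂ} (hb : 0 < b.re) {f g : V → ℂ} (hf : Integrable f) (hg : Integrable g) :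
    ∫ ξ, cexp (-b * (‖ξ‖ : ℂ) ^ 2) * (starRingEnd ℂ (𝓕 f ξ) * 𝓕 g ξ) =
      ∫ x, starRingEnd ℂ (f x) * ∫ y, ((Real.pi / b) ^ ((Module.finrank ℝ V : ℂ) / 2) *
        cexp (-(Real.pi : ℂ) ^ 2 * (‖x - y‖ : ℂ) ^ 2 / b)) * g y := by
  have hgauss : Integrable (fun ξ : V => cexp (-b * (‖ξ‖ : ℂ) ^ 2)) := by
    simpa using GaussianFourier.integrable_cexp_neg_mul_sq_norm_add hb 0 (0 : V)
  have hg' : Integrable (fun ξ : V => cexp (-b * (‖ξ‖ : ℂ) ^ 2) * 𝓕 g ξ) := by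
    refine hgauss.mul_bdd (c := ∫ x, ‖g x‖) (ft_continuous hg).aestronglyMeasurable ?_
    exact Filter.Eventually.of_forall (fun ξ => ft_norm_le g ξ)
  have hfst : Integrable (fun x => starRingEnd ℂ (f x)) := by
    exact (Complex.conjCLE.integrable_comp_iff (φ := f)).2 hf
  calc ∫ ξ, cexp (-b * (‖ξ‖ : ℂ) ^ 2) * (starRingEnd ℂ (𝓕 f ξ) * 𝓕 g ξ)
      = ∫ ξ, ∫ x, starRingEnd ℂ (f x) *
          (cexp (-b * (‖ξ‖ : ℂ) ^ 2 + 2 * Real.pi * I * (inner ℝ x ξ : ℝ)) * 𝓕 g ξ) := by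
        congr 1; ext ξ
        rw [Real.fourier_eq' f, ← integral_conj, mul_comm (∫ _, _), ← mul_assoc, ← integral_const_mul]
        congr 1; ext x
        simp only [smul_eq_mul, map_mul, ← Complex.exp_conj, Complex.conj_ofReal, Complex.conj_I,
          Complex.exp_add]
        rw [show ((-2 * Real.pi * inner ℝ x ξ : ℝ) : ℂ) * -I = 2 * Real.pi * I * (inner ℝ x ξ : ℝ) by
          push_cast; ring]
        ring
    _ = ∫ x, ∫ ξ, starRingEnd ℂ (f x) *
          (cexp (-b * (‖ξ‖ : ℂ) ^ 2 + 2 * Real.pi * I * (inner ℝ x ξ : ℝ)) * 𝓕 g ξ) := by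
        apply integral_integral_swap
        have h0 : Integrable (fun p : V × V => (cexp (-b * (‖p.1‖ : ℂ) ^ 2) * 𝓕 g p.1) *
            starRingEnd ℂ (f p.2)) (volume.prod volume) := hg'.mul_prod hfst
        have h1 := h0.bdd_mul (c := 1)
          (f := fun p : V × V => cexp (2 * Real.pi * I * (inner ℝ p.2 p.1 : ℝ)))
          (by apply Continuous.aestronglyMeasurable; fun_prop) (by
            refine Filter.Eventually.of_forall (fun p => ?_)
            rw [show 2 * (Real.pi : ℂ) * I * ((inner ℝ p.2 p.1 : ℝ) : ℂ) =
              ((2 * Real.pi * inner ℝ p.2 p.1 : ℝ) : ℂ) * I by push_cast; ring]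
            rw [Complex.norm_exp_ofReal_mul_I])
        refine h1.congr (Filter.Eventually.of_forall (fun p => ?_))
        simp only [Function.uncurry, Complex.exp_add]
        ring
    _ = _ := by
        congr 1; ext x
        rw [integral_const_mul, gauss_inv hb hg x]

lemma gauss_pair_bound {b : ℂ} (hb : 0 < b.re) {f g : V → ℂ} (hf : Integrable f)
    (hg : Integrable g) :
    ‖∫ ξ, cexp (-b * (‖ξ‖ : ℂ) ^ 2) * (starRingEnd ℂ (𝓕 f ξ) * 𝓕 g ξ)‖ ≤
      ‖(Real.pi / b) ^ ((Module.finrank ℝ V : ℂ) / 2)‖ * ((∫ x, ‖f x‖) * ∫ y, ‖g y‖) := by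
  rw [gauss_pair hb hf hg]
  set K := ‖(Real.pi / b) ^ ((Module.finrank ℝ V : ℂ) / 2)‖
  have h1 : ∀ x, ‖∫ y, ((Real.pi / b) ^ ((Module.finrank ℝ V : ℂ) / 2) *
        cexp (-(Real.pi : ℂ) ^ 2 * (‖x - y‖ : ℂ) ^ 2 / b)) * g y‖ ≤ K * ∫ y, ‖g y‖ := by
    intro x
    rw [← integral_const_mul]
    refine norm_integral_le_of_norm_le (hg.norm.const_mul K) (Filter.Eventually.of_forall ?_)
    intro y
    rw [norm_mul, norm_mul]
    have := exp_norm_le_one hb ‖x - y‖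
    gcongr
    exact mul_le_of_le_one_right (norm_nonneg _) this
  calc _ ≤ ∫ x, ‖f x‖ * (K * ∫ y, ‖g y‖) := by
        refine norm_integral_le_of_norm_le (hf.norm.mul_const _) (Filter.Eventually.of_forall ?_)
        intro x
        rw [norm_mul, RCLike.norm_conj]
        gcongr
        exact h1 x
    _ = _ := by rw [integral_mul_const]; ring

end FourierPart

section FourierPart2

variable {V : Type*} [NormedAddCommGroup V] [InnerProductSpace ℝ V] [FiniteDimensional ℝ V]
  [MeasurableSpace V] [BorelSpace V]

lemma young_aux {k a : V → ℝ≥0∞} (hk : Measurable k) (ha : AEMeasurable a)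
    (hk1 : ∫⁻ x, k x = 1) :
    ∫⁻ x, a x * ∫⁻ y, k (x - y) * a y ≤ ∫⁻ x, a x ^ 2 := by
  have ha1 : AEMeasurable (fun p : V × V => a p.1) (volume.prod volume) :=
    ha.comp_fst
  have ha2 : AEMeasurable (fun p : V × V => a p.2) (volume.prod volume) :=
    ha.comp_snd
  have hkk : AEMeasurable (fun p : V × V => k (p.1 - p.2)) (volume.prod volume) := by fun_prop
  have e1 : ∀ x, a x * ∫⁻ y, k (x - y) * a y = ∫⁻ y, a x * (k (x - y) * a y) := by
    intro x
    rw [lintegral_const_mul'']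
    refine AEMeasurable.mul (by fun_prop) ha
  have am : ∀ s t : ℝ≥0∞, 2 * (s * t) ≤ s ^ 2 + t ^ 2 := by
    intro s t
    induction s with
    | top => simp
    | coe s =>
      induction t with
      | top => simp
      | coe t =>
        norm_cast
        have := two_mul_le_add_sq s t
        linarith
  have h2 : 2 * ∫⁻ x, a x * ∫⁻ y, k (x - y) * a y ≤ 2 * ∫⁻ x, a x ^ 2 := by
    calc 2 * ∫⁻ x, a x * ∫⁻ y, k (x - y) * a y
        = 2 * ∫⁻ p : V × V, a p.1 * (k (p.1 - p.2) * a p.2) ∂(volume.prod volume) := by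
          rw [lintegral_prod _ (by exact ha1.mul (hkk.mul ha2))]
          simp_rw [e1]
      _ = ∫⁻ p : V × V, 2 * (a p.1 * (k (p.1 - p.2) * a p.2)) ∂(volume.prod volume) := by
          rw [lintegral_const_mul' _ _ (by simp)]
      _ ≤ ∫⁻ p : V × V, (k (p.1 - p.2) * a p.1 ^ 2 + k (p.1 - p.2) * a p.2 ^ 2)
            ∂(volume.prod volume) := by
          apply lintegral_mono
          intro p
          calc 2 * (a p.1 * (k (p.1 - p.2) * a p.2)) = k (p.1 - p.2) * (2 * (a p.1 * a p.2)) := by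
                ring
            _ ≤ k (p.1 - p.2) * (a p.1 ^ 2 + a p.2 ^ 2) := by gcongr; exact am _ _
            _ = _ := by ring
      _ = (∫⁻ p : V × V, k (p.1 - p.2) * a p.1 ^ 2 ∂(volume.prod volume)) +
            ∫⁻ p : V × V, k (p.1 - p.2) * a p.2 ^ 2 ∂(volume.prod volume) := by
          rw [lintegral_add_left' (by exact hkk.mul (ha1.pow_const 2))]
      _ = (∫⁻ x, a x ^ 2) + ∫⁻ x, a x ^ 2 := by
          congr 1
          · rw [lintegral_prod _ (by exact hkk.mul (ha1.pow_const 2))]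
            congr 1; ext x
            simp only
            rw [lintegral_mul_const'' _ (by fun_prop), lintegral_sub_left_eq_self, hk1, one_mul]
          · rw [lintegral_prod_symm _ (by exact hkk.mul (ha2.pow_const 2))]
            congr 1; ext x
            simp only
            rw [lintegral_mul_const'' _ (by fun_prop), lintegral_sub_right_eq_self, hk1, one_mul]
      _ = 2 * ∫⁻ x, a x ^ 2 := by rw [two_mul]
  exact (ENNReal.mul_le_mul_iff_right (by simp) (by simp)).1 h2

lemma gauss_k_integral {ε : ℝ} (hε : 0 < ε) :
    ∫⁻ z : V, ‖((Real.pi : ℂ) / (ε : ℂ)) ^ ((Module.finrank ℝ V : ℂ) / 2) *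
        cexp (-(Real.pi : ℂ) ^ 2 * (‖z‖ : ℂ) ^ 2 / (ε : ℂ))‖ₑ = 1 := by
  have h1 : ∀ z : V, ‖((Real.pi : ℂ) / (ε : ℂ)) ^ ((Module.finrank ℝ V : ℂ) / 2) *
        cexp (-(Real.pi : ℂ) ^ 2 * (‖z‖ : ℂ) ^ 2 / (ε : ℂ))‖ₑ =
      ENNReal.ofReal ((Real.pi / ε) ^ ((Module.finrank ℝ V : ℝ) / 2) *
        Real.exp (-(Real.pi ^ 2 / ε) * ‖z‖ ^ 2)) := by
    intro z
    rw [← ofReal_norm, norm_mul]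
    congr 2
    · rw [show (Real.pi : ℂ) / (ε : ℂ) = ((Real.pi / ε : ℝ) : ℂ) by push_cast; rfl,
        show ((Module.finrank ℝ V : ℂ) / 2) = (((Module.finrank ℝ V : ℝ) / 2 : ℝ) : ℂ) by
          push_cast; rfl, ← Complex.ofReal_cpow (by positivity), Complex.norm_real]
      exact Real.norm_of_nonneg (by positivity)
    · rw [Complex.norm_exp]
      congr 1
      rw [show (-(Real.pi : ℂ) ^ 2 * (‖z‖ : ℂ) ^ 2 / (ε : ℂ)) =
        ((-(Real.pi ^ 2 / ε) * ‖z‖ ^ 2 : ℝ) : ℂ) by push_cast; ring, Complex.ofReal_re]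
  simp_rw [h1]
  have hp : 0 < Real.pi ^ 2 / ε := by positivity
  have hIntble : Integrable (fun z : V => Real.exp (-(Real.pi ^ 2 / ε) * ‖z‖ ^ 2)) := by
    by_contra hcon
    have := GaussianFourier.integral_rexp_neg_mul_sq_norm (V := V) hp
    rw [integral_undef hcon] at this
    have h2 : 0 < (Real.pi / (Real.pi ^ 2 / ε)) ^ ((Module.finrank ℝ V : ℝ) / 2) := by positivity
    linarith
  rw [← ofReal_integral_eq_lintegral_ofReal (hIntble.const_mul _)
    (Filter.Eventually.of_forall (fun z => by positivity)), integral_const_mul,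
    GaussianFourier.integral_rexp_neg_mul_sq_norm hp, ← Real.mul_rpow (by positivity) (by positivity)]
  rw [show Real.pi / ε * (Real.pi / (Real.pi ^ 2 / ε)) = 1 by field_simp]
  simp

lemma gauss_l2 {ε : ℝ} (hε : 0 < ε) {f : V → ℂ} (hf : Integrable f) :
    ∫⁻ ξ, ENNReal.ofReal (Real.exp (-ε * ‖ξ‖ ^ 2)) * ‖𝓕 f ξ‖ₑ ^ 2 ≤ ∫⁻ x, ‖f x‖ₑ ^ 2 := by
  have hb : 0 < ((ε : ℂ)).re := by simpa using hε
  have h1 := gauss_pair hb hf hf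
  have hgauss : Integrable (fun ξ : V => cexp (-(ε : ℂ) * (‖ξ‖ : ℂ) ^ 2)) := by
    simpa using GaussianFourier.integrable_cexp_neg_mul_sq_norm_add hb 0 (0 : V)
  have hI : Integrable (fun ξ : V => cexp (-(ε : ℂ) * (‖ξ‖ : ℂ) ^ 2) *
      (starRingEnd ℂ (𝓕 f ξ) * 𝓕 f ξ)) := by
    have hc := ft_continuous hf
    refine hgauss.mul_bdd (c := (∫ x, ‖f x‖) * ∫ x, ‖f x‖)
      (by apply Continuous.aestronglyMeasurable; fun_prop) ?_
    refine Filter.Eventually.of_forall (fun ξ => ?_)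
    rw [norm_mul, RCLike.norm_conj]
    have := ft_norm_le f ξ
    gcongr
  have hreal : ∀ ξ : V, cexp (-(ε : ℂ) * (‖ξ‖ : ℂ) ^ 2) * (starRingEnd ℂ (𝓕 f ξ) * 𝓕 f ξ) =
      ((Real.exp (-ε * ‖ξ‖ ^ 2) * ‖𝓕 f ξ‖ ^ 2 : ℝ) : ℂ) := by
    intro ξ
    rw [mul_comm (starRingEnd ℂ _), Complex.mul_conj']
    push_cast
    rfl
  have hI' : Integrable (fun ξ : V => Real.exp (-ε * ‖ξ‖ ^ 2) * ‖𝓕 f ξ‖ ^ 2) := by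
    have := hI.re
    refine this.congr (Filter.Eventually.of_forall (fun ξ => ?_))
    simp only [hreal]
    exact RCLike.ofReal_re _
  have h2 : ∫⁻ ξ, ENNReal.ofReal (Real.exp (-ε * ‖ξ‖ ^ 2)) * ‖𝓕 f ξ‖ₑ ^ 2 =
      ‖∫ ξ, cexp (-(ε : ℂ) * (‖ξ‖ : ℂ) ^ 2) * (starRingEnd ℂ (𝓕 f ξ) * 𝓕 f ξ)‖ₑ := by
    simp_rw [hreal]
    rw [integral_complex_ofReal, ← ofReal_norm, Complex.norm_real, Real.norm_of_nonneg
      (integral_nonneg (fun ξ => by positivity)), ofReal_integral_eq_lintegral_ofReal hI'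
      (Filter.Eventually.of_forall (fun z => by positivity))]
    congr 1; ext ξ
    rw [ENNReal.ofReal_mul (by positivity), ENNReal.ofReal_pow (by positivity), ofReal_norm]
  rw [h2, h1]
  refine (enorm_integral_le_lintegral_enorm _).trans ?_
  refine le_trans ?_ (young_aux (V := V) (k := fun z => ‖((Real.pi : ℂ) / (ε : ℂ)) ^
    ((Module.finrank ℝ V : ℂ) / 2) * cexp (-(Real.pi : ℂ) ^ 2 * (‖z‖ : ℂ) ^ 2 / (ε : ℂ))‖ₑ)
    (a := fun x => ‖f x‖ₑ) (by fun_prop) hf.aestronglyMeasurable.enorm (gauss_k_integral hε))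
  apply lintegral_mono
  intro x
  simp only [enorm_mul]
  gcongr
  · exact le_of_eq (by rw [← ofReal_norm, RCLike.norm_conj, ofReal_norm])
  · refine (enorm_integral_le_lintegral_enorm _).trans ?_
    simp only [enorm_mul]
    exact le_rfl

lemma ft_l2_le {f : V → ℂ} (hf : Integrable f) :
    ∫⁻ ξ, ‖𝓕 f ξ‖ₑ ^ 2 ≤ ∫⁻ x, ‖f x‖ₑ ^ 2 := by
  have hlim : ∀ ξ : V, Filter.Tendsto (fun n : ℕ =>
      ENNReal.ofReal (Real.exp (-(1 / ((n : ℝ) + 1)) * ‖ξ‖ ^ 2)) * ‖𝓕 f ξ‖ₑ ^ 2) Filter.atTop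
      (nhds (‖𝓕 f ξ‖ₑ ^ 2)) := by
    intro ξ
    have h1 : Filter.Tendsto (fun n : ℕ => Real.exp (-(1 / ((n : ℝ) + 1)) * ‖ξ‖ ^ 2)) Filter.atTop
        (nhds 1) := by
      have h0 := (tendsto_one_div_add_atTop_nhds_zero_nat (𝕜 := ℝ)).neg.mul_const (‖ξ‖ ^ 2)
      simpa [Function.comp_def] using (Real.continuous_exp.tendsto _).comp h0
    have h2 := ENNReal.tendsto_ofReal h1
    have := ENNReal.Tendsto.mul_const (b := ‖𝓕 f ξ‖ₑ ^ 2) h2 (Or.inl (by simp))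
    simpa using this
  calc ∫⁻ ξ, ‖𝓕 f ξ‖ₑ ^ 2 = ∫⁻ ξ, Filter.liminf (fun n : ℕ =>
      ENNReal.ofReal (Real.exp (-(1 / ((n : ℝ) + 1)) * ‖ξ‖ ^ 2)) * ‖𝓕 f ξ‖ₑ ^ 2) Filter.atTop := by
        congr 1; ext ξ; exact (hlim ξ).liminf_eq.symm
    _ ≤ Filter.liminf (fun n : ℕ => ∫⁻ ξ, 
      ENNReal.ofReal (Real.exp (-(1 / ((n : ℝ) + 1)) * ‖ξ‖ ^ 2)) * ‖𝓕 f ξ‖ₑ ^ 2) Filter.atTop := by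
        apply lintegral_liminf_le
        intro n
        have := ft_continuous hf
        exact Measurable.mul (by fun_prop) (this.measurable.enorm.pow_const 2)
    _ ≤ _ := by
        refine Filter.liminf_le_of_le (by isBoundedDefault) ?_
        intro b hb
        obtain ⟨n, hn⟩ := hb.exists
        exact hn.trans (gauss_l2 (by positivity) hf)

lemma ft_eLpNorm_le {f : V → ℂ} (hf : Integrable f) : eLpNorm (𝓕 f) 2 volume ≤ eLpNorm f 2 volume := by
  rw [eLpNorm_eq_lintegral_rpow_enorm_toReal (by simp) (by simp),
    eLpNorm_eq_lintegral_rpow_enorm_toReal (by simp) (by simp)]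
  have := ft_l2_le hf
  simp only [ENNReal.toReal_ofNat, ENNReal.rpow_ofNat]
  gcongr

lemma ft_memLp {f : V → ℂ} (hf : Integrable f) (hf2 : MemLp f 2 volume) : MemLp (𝓕 f) 2 volume :=
  ⟨(ft_continuous hf).aestronglyMeasurable, (ft_eLpNorm_le hf).trans_lt hf2.2⟩

end FourierPart2

section FourierPart3

variable {V : Type*} [NormedAddCommGroup V] [InnerProductSpace ℝ V] [FiniteDimensional ℝ V]
  [MeasurableSpace V] [BorelSpace V]

lemma tendsto_b (τ : ℝ) : Filter.Tendsto (fun n : ℕ => ((1 / ((n : ℝ) + 1) : ℝ) : ℂ) - τ * I)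
    Filter.atTop (nhds (-(τ * I))) := by
  have h0 := (tendsto_one_div_add_atTop_nhds_zero_nat (𝕜 := ℝ))
  have h1 := (Complex.continuous_ofReal.tendsto 0).comp h0
  have h2 := h1.sub_const ((τ : ℂ) * I)
  simpa [Function.comp_def] using h2

lemma b_re (τ : ℝ) (n : ℕ) : 0 < (((1 / ((n : ℝ) + 1) : ℝ) : ℂ) - τ * I).re := by
  rw [Complex.sub_re, Complex.ofReal_re]
  simp
  positivity

lemma exp_b_norm (τ : ℝ) (n : ℕ) (r : ℝ) :
    ‖cexp (-(((1 / ((n : ℝ) + 1) : ℝ) : ℂ) - τ * I) * (r : ℂ) ^ 2)‖ ≤ 1 := by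
  rw [Complex.norm_exp]
  apply Real.exp_le_one_iff.2
  rw [show (r : ℂ) ^ 2 = ((r ^ 2 : ℝ) : ℂ) by push_cast; rfl, mul_comm, Complex.re_ofReal_mul,
    Complex.neg_re]
  have := b_re τ n
  nlinarith [sq_nonneg r]

lemma dispersive {f g : V → ℂ} (hf : Integrable f) (hg : Integrable g) (hf2 : MemLp f 2 volume)
    (hg2 : MemLp g 2 volume) {τ : ℝ} (hτ : τ ≠ 0) :
    ‖∫ ξ, cexp ((τ * ‖ξ‖ ^ 2 : ℝ) * I) * (starRingEnd ℂ (𝓕 f ξ) * 𝓕 g ξ)‖ ≤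
      (Real.pi / |τ|) ^ ((Module.finrank ℝ V : ℝ) / 2) * ((∫ x, ‖f x‖) * ∫ y, ‖g y‖) := by
  have hIntble : Integrable (fun ξ => starRingEnd ℂ (𝓕 f ξ) * 𝓕 g ξ) := by
    have h1 := (ft_memLp hf hf2).star.integrable_mul (ft_memLp hg hg2)
    exact h1
  have hcf := ft_continuous hf
  have hcg := ft_continuous hg
  have hlim : Filter.Tendsto (fun n : ℕ => ∫ ξ, cexp (-(((1 / ((n : ℝ) + 1) : ℝ) : ℂ) - τ * I) *
      (‖ξ‖ : ℂ) ^ 2) * (starRingEnd ℂ (𝓕 f ξ) * 𝓕 g ξ)) Filter.atTop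
      (nhds (∫ ξ, cexp ((τ * ‖ξ‖ ^ 2 : ℝ) * I) * (starRingEnd ℂ (𝓕 f ξ) * 𝓕 g ξ))) := by
    refine tendsto_integral_of_dominated_convergence (fun ξ => ‖starRingEnd ℂ (𝓕 f ξ) * 𝓕 g ξ‖)
      ?_ hIntble.norm ?_ ?_
    · intro n
      apply Continuous.aestronglyMeasurable
      fun_prop
    · intro n
      refine Filter.Eventually.of_forall (fun ξ => ?_)
      rw [norm_mul]
      exact mul_le_of_le_one_left (norm_nonneg _) (exp_b_norm τ n ‖ξ‖)
    · refine Filter.Eventually.of_forall (fun ξ => ?_)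
      refine Filter.Tendsto.mul_const _ ?_
      have h1 := ((tendsto_b τ).neg).mul_const ((‖ξ‖ : ℂ) ^ 2)
      have h2 := (Complex.continuous_exp.tendsto _).comp h1
      rw [show ((τ * ‖ξ‖ ^ 2 : ℝ) : ℂ) * I = - -((τ : ℂ) * I) * (‖ξ‖ : ℂ) ^ 2 by push_cast; ring]
      exact h2
  refine le_of_tendsto hlim.norm (Filter.Eventually.of_forall (fun n => ?_))
  refine (gauss_pair_bound (b_re τ n) hf hg).trans ?_
  have hnn : 0 ≤ (∫ x, ‖f x‖) * ∫ y, ‖g y‖ :=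
    mul_nonneg (integral_nonneg fun _ => norm_nonneg _) (integral_nonneg fun _ => norm_nonneg _)
  refine mul_le_mul_of_nonneg_right ?_ hnn
  rw [show ((Module.finrank ℝ V : ℂ) / 2) = (((Module.finrank ℝ V : ℝ) / 2 : ℝ) : ℂ) by
          push_cast; rfl, Complex.norm_cpow_real, norm_div]
  have hτ' : 0 < |τ| := abs_pos.2 hτ
  have h3 : |τ| ≤ ‖((1 / ((n : ℝ) + 1) : ℝ) : ℂ) - τ * I‖ := by
    have h4 := Complex.abs_im_le_norm (((1 / ((n : ℝ) + 1) : ℝ) : ℂ) - τ * I)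
    rw [Complex.sub_im, Complex.ofReal_im] at h4
    simpa using h4
  rw [Complex.norm_real, Real.norm_of_nonneg Real.pi_pos.le]
  gcongr

end FourierPart3

lemma schrod_eq {d : ℕ} {s : ℝ} (hs : s ≠ 0) {φ : EuclideanSpace ℝ (Fin d) → ℂ}
    (hφ : Integrable φ) (hφ' : Integrable (𝓕 φ)) (x : EuclideanSpace ℝ (Fin d)) :
    schrod d (-s) φ x = ∫ ξ, cexp (2 * Real.pi * I * (inner ℝ x ξ : ℝ)) *
      (cexp ((4 * Real.pi ^ 2 * s * ‖ξ‖ ^ 2 : ℝ) * I) * 𝓕 φ ξ) := by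
  set τ : ℝ := 4 * Real.pi ^ 2 * s with hτ
  have hpi := Real.pi_pos
  have hτ0 : τ ≠ 0 := by rw [hτ]; positivity
  have hcf := ft_continuous hφ
  have hlim1 : Filter.Tendsto (fun n : ℕ => ∫ ξ : EuclideanSpace ℝ (Fin d),
      cexp (-(((1 / ((n : ℝ) + 1) : ℝ) : ℂ) - τ * I) *
      (‖ξ‖ : ℂ) ^ 2 + 2 * Real.pi * I * (inner ℝ x ξ : ℝ)) * 𝓕 φ ξ) Filter.atTop
      (nhds (∫ ξ, cexp (2 * Real.pi * I * (inner ℝ x ξ : ℝ)) *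
      (cexp ((τ * ‖ξ‖ ^ 2 : ℝ) * I) * 𝓕 φ ξ))) := by
    refine tendsto_integral_of_dominated_convergence (fun ξ => ‖𝓕 φ ξ‖)
      ?_ hφ'.norm ?_ ?_
    · intro n
      apply Continuous.aestronglyMeasurable
      fun_prop
    · intro n
      refine Filter.Eventually.of_forall (fun ξ => ?_)
      rw [norm_mul, Complex.exp_add, norm_mul]
      have h1 : ‖cexp (2 * Real.pi * I * (inner ℝ x ξ : ℝ))‖ = 1 := by
        rw [show 2 * (Real.pi : ℂ) * I * ((inner ℝ x ξ : ℝ) : ℂ) =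
              ((2 * Real.pi * inner ℝ x ξ : ℝ) : ℂ) * I by push_cast; ring]
        rw [Complex.norm_exp_ofReal_mul_I]
      rw [h1, mul_one]
      exact mul_le_of_le_one_left (norm_nonneg _) (exp_b_norm τ n ‖ξ‖)
    · refine Filter.Eventually.of_forall (fun ξ => ?_)
      rw [← mul_assoc, ← Complex.exp_add]
      refine Filter.Tendsto.mul_const _ ?_
      have h1 := (((tendsto_b τ).neg).mul_const ((‖ξ‖ : ℂ) ^ 2)).add_const
        (2 * Real.pi * I * (inner ℝ x ξ : ℝ))
      have h2 := (Complex.continuous_exp.tendsto _).comp h1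
      rw [show 2 * (Real.pi : ℂ) * I * ((inner ℝ x ξ : ℝ) : ℂ) + ((τ * ‖ξ‖ ^ 2 : ℝ) : ℂ) * I =
        - -((τ : ℂ) * I) * (‖ξ‖ : ℂ) ^ 2 + 2 * (Real.pi : ℂ) * I * ((inner ℝ x ξ : ℝ) : ℂ) by
          push_cast; ring]
      exact h2
  have hbne : -((τ : ℂ) * I) ≠ 0 := by
    simp [hτ0]
  have hlim2 : Filter.Tendsto (fun n : ℕ => ∫ y : EuclideanSpace ℝ (Fin d),
      cexp (-(Real.pi : ℂ) ^ 2 * (‖x - y‖ : ℂ) ^ 2 / (((1 / ((n : ℝ) + 1) : ℝ) : ℂ) - τ * I)) * φ y)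
      Filter.atTop
      (nhds (∫ y, cexp (-(Real.pi : ℂ) ^ 2 * (‖x - y‖ : ℂ) ^ 2 / -(τ * I)) * φ y)) := by
    refine tendsto_integral_of_dominated_convergence (fun ξ => ‖φ ξ‖)
      ?_ hφ.norm ?_ ?_
    · intro n
      refine AEStronglyMeasurable.mul ?_ hφ.aestronglyMeasurable
      apply Continuous.aestronglyMeasurable
      fun_prop
    · intro n
      refine Filter.Eventually.of_forall (fun y => ?_)
      rw [norm_mul]
      exact mul_le_of_le_one_left (norm_nonneg _) (exp_norm_le_one (b_re τ n) _)
    · refine Filter.Eventually.of_forall (fun y => ?_)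
      refine Filter.Tendsto.mul_const _ ?_
      exact (Complex.continuous_exp.tendsto _).comp (tendsto_const_nhds.div (tendsto_b τ) hbne)
  have hlim3 : Filter.Tendsto (fun n : ℕ => ((Real.pi : ℂ) /
      (((1 / ((n : ℝ) + 1) : ℝ) : ℂ) - τ * I)) ^ ((d : ℂ) / 2)) Filter.atTop
      (nhds (((Real.pi : ℂ) / -(τ * I)) ^ ((d : ℂ) / 2))) := by
    have h1 := (tendsto_const_nhds (x := (Real.pi : ℂ))).div (tendsto_b τ) hbne
    have hsl : ((Real.pi : ℂ) / -(τ * I)) ∈ Complex.slitPlane := by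
      right
      rw [show (Real.pi : ℂ) / -(τ * I) = ((Real.pi / τ : ℝ) : ℂ) * I by
        push_cast
        rw [div_eq_iff hbne]
        have : (τ : ℂ) ≠ 0 := by exact_mod_cast hτ0
        field_simp
        simp]
      simp [hτ0, hpi.ne']
    exact (continuousAt_cpow_const hsl).tendsto.comp h1
  have hfin : Module.finrank ℝ (EuclideanSpace ℝ (Fin d)) = d := by simp
  have heq : ∀ n : ℕ, ∫ ξ : EuclideanSpace ℝ (Fin d),
      cexp (-(((1 / ((n : ℝ) + 1) : ℝ) : ℂ) - τ * I) *
      (‖ξ‖ : ℂ) ^ 2 + 2 * Real.pi * I * (inner ℝ x ξ : ℝ)) * 𝓕 φ ξ =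
      ((Real.pi : ℂ) / (((1 / ((n : ℝ) + 1) : ℝ) : ℂ) - τ * I)) ^ ((d : ℂ) / 2) *
      ∫ y : EuclideanSpace ℝ (Fin d),
      cexp (-(Real.pi : ℂ) ^ 2 * (‖x - y‖ : ℂ) ^ 2 / (((1 / ((n : ℝ) + 1) : ℝ) : ℂ) - τ * I)) * φ y := by
    intro n
    rw [gauss_inv (b_re τ n) hφ x, hfin, ← integral_const_mul]
    congr 1; ext y; ring
  simp_rw [heq] at hlim1
  have huniq := tendsto_nhds_unique (hlim3.mul hlim2) hlim1
  rw [← huniq, schrod]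
  have hs' : (s : ℂ) ≠ 0 := by exact_mod_cast hs
  have hpi' : (Real.pi : ℂ) ≠ 0 := by exact_mod_cast hpi.ne'
  congr 1
  · have e1 : (Real.pi : ℂ) / -((τ : ℂ) * I) = (((4 * Real.pi * (-s) : ℝ) : ℂ) * I)⁻¹ := by
      rw [hτ]; push_cast; field_simp
    rw [e1, Complex.inv_cpow, neg_div, Complex.cpow_neg]
    rw [Ne, Complex.arg_eq_pi_iff]
    simp [hs, hpi.ne']
  · congr 1; ext y
    congr 2
    rw [hτ]; push_cast
    field_simp
    ring_nf
    simp [I_sq]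

section SlicePart

set_option linter.unusedSectionVars false

variable {V : Type*} [NormedAddCommGroup V] [InnerProductSpace ℝ V] [FiniteDimensional ℝ V]
  [MeasurableSpace V] [BorelSpace V]

lemma slice_deriv (F : 𝓢(ℝ × V, ℂ)) (s : ℝ) (n : ℕ) (x : V) :
    ‖iteratedFDeriv ℝ n (fun y => F (s, y)) x‖ ≤ ‖iteratedFDeriv ℝ n F (s, x)‖ := by
  have h1 : (fun y => F (s, y)) = (fun z : ℝ × V => F ((s, 0) + z)) ∘ (ContinuousLinearMap.inr ℝ ℝ V) := by
    ext y; simp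
  have hsm : ContDiff ℝ n (fun z : ℝ × V => F ((s, 0) + z)) := by
    have := F.smooth n
    fun_prop
  rw [h1, ContinuousLinearMap.iteratedFDeriv_comp_right _ hsm _ le_rfl]
  refine (ContinuousMultilinearMap.norm_compContinuousLinearMap_le _ _).trans ?_
  rw [iteratedFDeriv_comp_add_left]
  simp only [ContinuousLinearMap.inr_apply, Prod.mk_add_mk, add_zero, zero_add]
  refine mul_le_of_le_one_right (norm_nonneg _) ?_
  refine Finset.prod_le_one (fun _ _ => norm_nonneg _) (fun _ _ => ?_)
  exact ContinuousLinearMap.norm_inr_le_one ℝ ℝ V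

lemma slice_decay (F : 𝓢(ℝ × V, ℂ)) (k n : ℕ) : ∃ C : ℝ, 0 ≤ C ∧ ∀ (s : ℝ) (x : V),
    (1 + s ^ 2) * (‖x‖ ^ k * ‖iteratedFDeriv ℝ n (fun y => F (s, y)) x‖) ≤ C := by
  obtain ⟨C1, h1⟩ := F.decay k n
  obtain ⟨C2, h2⟩ := F.decay (k + 2) n
  refine ⟨max 0 (C1 + C2), le_max_left _ _, fun s x => le_trans ?_ (le_max_right _ _)⟩
  have h0 := slice_deriv F s n x
  have hs : |s| ≤ ‖(s, x)‖ := by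
    exact norm_fst_le (s, x)
  have hx : ‖x‖ ≤ ‖(s, x)‖ := norm_snd_le (s, x)
  have hs2 : s ^ 2 ≤ ‖(s, x)‖ ^ 2 := by rw [← sq_abs]; gcongr
  calc (1 + s ^ 2) * (‖x‖ ^ k * ‖iteratedFDeriv ℝ n (fun y => F (s, y)) x‖)
      ≤ (1 + ‖(s, x)‖ ^ 2) * (‖(s, x)‖ ^ k * ‖iteratedFDeriv ℝ n F (s, x)‖) := by gcongr
    _ = ‖(s, x)‖ ^ k * ‖iteratedFDeriv ℝ n F (s, x)‖ +
        ‖(s, x)‖ ^ (k + 2) * ‖iteratedFDeriv ℝ n F (s, x)‖ := by ring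
    _ ≤ C1 + C2 := add_le_add (h1.2 _) (h2.2 _)

/-- The slice `F (s, ·)` as a Schwartz function. -/
def slice (F : 𝓢(ℝ × V, ℂ)) (s : ℝ) : 𝓢(V, ℂ) where
  toFun := fun y => F (s, y)
  smooth' := by
    have := F.smooth ⊤
    fun_prop
  decay' := by
    intro k n
    obtain ⟨C, hC, h⟩ := slice_decay F k n
    refine ⟨C, fun x => le_trans ?_ (h s x)⟩
    refine le_mul_of_one_le_left (by positivity) ?_
    nlinarith [sq_nonneg s]

lemma slice_seminorm (F : 𝓢(ℝ × V, ℂ)) (k n : ℕ) : ∃ C : ℝ, 0 ≤ C ∧ ∀ (s : ℝ),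
    SchwartzMap.seminorm ℂ k n (slice F s) ≤ C * (1 + s ^ 2)⁻¹ := by
  obtain ⟨C, hC, h⟩ := slice_decay F k n
  refine ⟨C, hC, fun s => ?_⟩
  refine SchwartzMap.seminorm_le_bound ℂ k n _ (by positivity) (fun x => ?_)
  have h1 : (0 : ℝ) < 1 + s ^ 2 := by positivity
  rw [← div_eq_mul_inv, le_div_iff₀ h1, mul_comm]
  exact h s x

lemma slice_sup_seminorm (F : 𝓢(ℝ × V, ℂ)) (m : Finset (ℕ × ℕ)) : ∃ C : ℝ, 0 ≤ C ∧ ∀ (s : ℝ),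
    (m.sup (schwartzSeminormFamily ℂ V ℂ)) (slice F s) ≤ C * (1 + s ^ 2)⁻¹ := by
  choose C hC h using fun p : ℕ × ℕ => slice_seminorm F p.1 p.2
  refine ⟨∑ p ∈ m, C p, Finset.sum_nonneg (fun p _ => hC p), fun s => ?_⟩
  refine Seminorm.finset_sup_apply_le
    (mul_nonneg (Finset.sum_nonneg (fun p _ => hC p)) (by positivity)) (fun p hp => ?_)
  refine (h p s).trans ?_
  gcongr
  exact Finset.single_le_sum (f := C) (fun p _ => hC p) hp

lemma schwartz_decay (m : ℕ) : ∃ S : Finset (ℕ × ℕ), ∃ C : ℝ, 0 ≤ C ∧ ∀ (φ : 𝓢(V, ℂ)) (x : V),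
    ‖φ x‖ ≤ C * (S.sup (schwartzSeminormFamily ℂ V ℂ)) φ * ((1 + ‖x‖) ^ m)⁻¹ := by
  refine ⟨Finset.Iic (m, 0), 2 ^ m, by positivity, fun φ x => ?_⟩
  have h := SchwartzMap.one_add_le_sup_seminorm_apply (𝕜 := ℂ) (m := (m, 0)) (k := m) (n := 0)
    le_rfl le_rfl φ x
  rw [norm_iteratedFDeriv_zero] at h
  have h1 : (0 : ℝ) < (1 + ‖x‖) ^ m := by positivity
  rw [← div_eq_mul_inv, le_div_iff₀ h1, mul_comm]
  exact h

lemma slice_bound (F : 𝓢(ℝ × V, ℂ)) (m : ℕ) : ∃ C : ℝ, 0 ≤ C ∧ ∀ (s : ℝ) (x : V),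
    ‖F (s, x)‖ ≤ C * ((1 + s ^ 2)⁻¹ * ((1 + ‖x‖) ^ m)⁻¹) := by
  obtain ⟨S, C1, hC1, h1⟩ := schwartz_decay (V := V) m
  obtain ⟨C2, hC2, h2⟩ := slice_sup_seminorm F S
  refine ⟨C1 * C2, by positivity, fun s x => (h1 (slice F s) x).trans ?_⟩
  have := h2 s
  calc _ ≤ C1 * (C2 * (1 + s ^ 2)⁻¹) * ((1 + ‖x‖) ^ m)⁻¹ := by gcongr
    _ = _ := by ring

lemma slice_fourier_bound (F : 𝓢(ℝ × V, ℂ)) (m : ℕ) : ∃ C : ℝ, 0 ≤ C ∧ ∀ (s : ℝ) (ξ : V),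
    ‖𝓕 (fun y => F (s, y)) ξ‖ ≤ C * ((1 + s ^ 2)⁻¹ * ((1 + ‖ξ‖) ^ m)⁻¹) := by
  obtain ⟨S, C1, hC1, h1⟩ := schwartz_decay (V := V) m
  have hcont : Continuous ((S.sup (schwartzSeminormFamily ℂ V ℂ)).comp
      (SchwartzMap.fourierTransformCLM ℂ : 𝓢(V, ℂ) →L[ℂ] 𝓢(V, ℂ)).toLinearMap) := by
    have h0 : Continuous (⇑(S.sup (schwartzSeminormFamily ℂ V ℂ) : Seminorm ℂ 𝓢(V, ℂ))) := by
      classical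
      clear h1
      induction S using Finset.induction_on with
      | empty => exact continuous_const
      | insert a S _ ih =>
        rw [Finset.sup_insert]
        exact ((schwartz_withSeminorms ℂ V ℂ).continuous_seminorm a).max (ih)
    exact h0.comp (SchwartzMap.fourierTransformCLM ℂ).continuous
  obtain ⟨S2, C0, hC0, h0⟩ := Seminorm.bound_of_continuous (schwartz_withSeminorms ℂ V ℂ) _ hcont
  obtain ⟨C2, hC2, h2⟩ := slice_sup_seminorm F S2
  refine ⟨C1 * (C0 * C2), by positivity, fun s x => ?_⟩
  have h3 := h1 (SchwartzMap.fourierTransformCLM ℂ (slice F s)) x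
  have h4 : (S.sup (schwartzSeminormFamily ℂ V ℂ)) (SchwartzMap.fourierTransformCLM ℂ (slice F s)) ≤
      C0 * (C2 * (1 + s ^ 2)⁻¹) := by
    refine (h0 (slice F s)).trans ?_
    have := h2 s
    simp only [smul_apply, NNReal.smul_def, smul_eq_mul]
    gcongr
  have h5 : ‖𝓕 (fun y => F (s, y)) x‖ = ‖(SchwartzMap.fourierTransformCLM ℂ (slice F s)) x‖ := by
    rfl
  rw [h5]
  refine h3.trans ?_
  calc _ ≤ C1 * (C0 * (C2 * (1 + s ^ 2)⁻¹)) * ((1 + ‖x‖) ^ m)⁻¹ := by gcongr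
    _ = _ := by ring

lemma integrable_weight : Integrable (fun x : V => ((1 + ‖x‖) ^ (Module.finrank ℝ V + 1))⁻¹) := by
  have := integrable_one_add_norm (E := V) (μ := volume) (r := (Module.finrank ℝ V : ℝ) + 1) (by simp)
  refine this.congr (Filter.Eventually.of_forall (fun x => ?_))
  simp only
  rw [Real.rpow_neg (by positivity)]
  norm_cast

end SlicePart

section LhsPart

set_option linter.unusedSectionVars false

variable {V : Type*} [NormedAddCommGroup V] [InnerProductSpace ℝ V] [FiniteDimensional ℝ V]
  [MeasurableSpace V] [BorelSpace V]

/-- Phase times partial Fourier transform. -/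
def pft (G : ℝ × V → ℂ) (s : ℝ) (ξ : V) : ℂ :=
  cexp ((4 * Real.pi ^ 2 * s * ‖ξ‖ ^ 2 : ℝ) * I) * 𝓕 (fun y => G (s, y)) ξ

lemma pft_norm (G : ℝ × V → ℂ) (s : ℝ) (ξ : V) : ‖pft G s ξ‖ = ‖𝓕 (fun y => G (s, y)) ξ‖ := by
  rw [pft, norm_mul, Complex.norm_exp_ofReal_mul_I, one_mul]

lemma pft_measurable {G : ℝ × V → ℂ} (hG : Measurable G) :
    Measurable (fun p : ℝ × V => pft G p.1 p.2) := by
  unfold pft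
  refine Measurable.mul (by fun_prop) ?_
  simp_rw [Real.fourier_eq']
  have : StronglyMeasurable (fun p : (ℝ × V) × V => cexp (((-2 * Real.pi * inner ℝ p.2 p.1.2 : ℝ) : ℂ) * I)
      • G (p.1.1, p.2)) := by
    apply Measurable.stronglyMeasurable
    fun_prop
  exact (StronglyMeasurable.integral_prod_right this).measurable

lemma pft_integrable (F : 𝓢(ℝ × V, ℂ)) :
    Integrable (fun p : ℝ × V => pft F p.1 p.2) (volume.prod volume) := by
  obtain ⟨C, hC, h⟩ := slice_fourier_bound F (Module.finrank ℝ V + 1)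
  have h1 : Integrable (fun p : ℝ × V => (1 + p.1 ^ 2)⁻¹ * ((1 + ‖p.2‖) ^ (Module.finrank ℝ V + 1))⁻¹)
      (volume.prod volume) := integrable_inv_one_add_sq.mul_prod integrable_weight
  refine (h1.const_mul C).mono' (pft_measurable F.continuous.measurable).aestronglyMeasurable ?_
  refine Filter.Eventually.of_forall (fun p => ?_)
  rw [pft_norm]
  exact h p.1 p.2

lemma slice_integrable (F : 𝓢(ℝ × V, ℂ)) (s : ℝ) : Integrable (fun y => F (s, y)) :=
  (slice F s).integrable

lemma slice_ft_integrable (F : 𝓢(ℝ × V, ℂ)) (s : ℝ) : Integrable (𝓕 (fun y => F (s, y))) :=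
  (SchwartzMap.fourierTransformCLM ℂ (slice F s)).integrable

end LhsPart

lemma lhs_le {d : ℕ} (F : 𝓢(ℝ × EuclideanSpace ℝ (Fin d), ℂ)) :
    eLpNorm (fun x : EuclideanSpace ℝ (Fin d) => ∫ s : ℝ, schrod d (-s) (fun y => F (s, y)) x) 2 volume
      ≤ eLpNorm (fun ξ : EuclideanSpace ℝ (Fin d) => ∫ s : ℝ, pft F s ξ) 2 volume := by
  have hI := pft_integrable F
  have hW : Integrable (fun ξ : EuclideanSpace ℝ (Fin d) => ∫ s : ℝ, pft F s ξ) :=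
    hI.integral_prod_right
  have heq : (fun x : EuclideanSpace ℝ (Fin d) => ∫ s : ℝ, schrod d (-s) (fun y => F (s, y)) x) =
      (𝓕 (fun ξ : EuclideanSpace ℝ (Fin d) => ∫ s : ℝ, pft F s ξ)) ∘ (fun x => -x) := by
    ext x
    have hph : ∀ ξ : EuclideanSpace ℝ (Fin d), 2 * (Real.pi : ℂ) * I * ((inner ℝ x ξ : ℝ) : ℂ) =
        ((-2 * Real.pi * inner ℝ ξ (-x) : ℝ) : ℂ) * I := by
      intro ξ
      rw [inner_neg_right, real_inner_comm]
      push_cast; ring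
    calc ∫ s : ℝ, schrod d (-s) (fun y => F (s, y)) x
        = ∫ s : ℝ, ∫ ξ, cexp (2 * Real.pi * I * (inner ℝ x ξ : ℝ)) * pft F s ξ := by
          apply integral_congr_ae
          have : ∀ᵐ s : ℝ, s ≠ 0 := by simp [ae_iff]
          filter_upwards [this] with s hs
          rw [schrod_eq hs (slice_integrable F s) (slice_ft_integrable F s) x]
          rfl
      _ = ∫ ξ, ∫ s : ℝ, cexp (2 * Real.pi * I * (inner ℝ x ξ : ℝ)) * pft F s ξ := by
          apply integral_integral_swap
          refine hI.bdd_mul (c := 1) (f := fun p : ℝ × EuclideanSpace ℝ (Fin d) =>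
            cexp (2 * Real.pi * I * (inner ℝ x p.2 : ℝ))) ?_ ?_
          · apply Continuous.aestronglyMeasurable; fun_prop
          · refine Filter.Eventually.of_forall (fun p => ?_)
            rw [hph, Complex.norm_exp_ofReal_mul_I]
      _ = _ := by
          rw [Function.comp_apply, Real.fourier_eq']
          congr 1; ext ξ
          rw [integral_const_mul, hph, smul_eq_mul]
  rw [heq, eLpNorm_comp_measurePreserving (ft_continuous hW).aestronglyMeasurable
    (Measure.measurePreserving_neg volume)]
  exact ft_eLpNorm_le hW

lemma stronglyMeasurable_of_edist {X : Type*} [PseudoEMetricSpace X]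
    [SecondCountableTopology X] [TopologicalSpace.PseudoMetrizableSpace X] {f : ℝ → X}
    (h : ∀ a, Measurable (fun s => edist (f s) a)) : StronglyMeasurable f := by
  borelize X
  refine Measurable.stronglyMeasurable ?_
  refine measurable_of_isOpen (fun U hU => ?_)
  have h1 : ∀ x : U, ∃ r > 0, Metric.eball (x : X) r ⊆ U := fun x =>
    EMetric.isOpen_iff.1 hU x x.2
  choose r hr hrU using h1
  obtain ⟨T, hT, hTU⟩ := TopologicalSpace.isOpen_iUnion_countable
    (fun x : U => Metric.eball (x : X) (r x)) (fun x => Metric.isOpen_eball)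
  have hU2 : U = ⋃ i ∈ T, Metric.eball (i : X) (r i) := by
    rw [hTU]
    apply Set.Subset.antisymm
    · intro x hx
      exact Set.mem_iUnion.2 ⟨⟨x, hx⟩, Metric.mem_eball_self (hr ⟨x, hx⟩)⟩
    · exact Set.iUnion_subset hrU
  rw [hU2, Set.preimage_iUnion₂]
  refine MeasurableSet.biUnion hT (fun i _ => ?_)
  exact measurableSet_lt (h i) measurable_const

section LpPart

set_option linter.unusedSectionVars false

variable {V : Type*} [NormedAddCommGroup V] [InnerProductSpace ℝ V] [FiniteDimensional ℝ V]
  [MeasurableSpace V] [BorelSpace V]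

/-- Measurable functions dominated by a fixed integrable profile. -/
def Dom (G : ℝ × V → ℂ) : Prop := Measurable G ∧ ∃ C : ℝ, 0 ≤ C ∧ ∀ (s : ℝ) (x : V),
  ‖G (s, x)‖ ≤ C * ((1 + s ^ 2)⁻¹ * ((1 + ‖x‖) ^ (Module.finrank ℝ V + 1))⁻¹)

lemma dom_schwartz (F : 𝓢(ℝ × V, ℂ)) : Dom (F : ℝ × V → ℂ) :=
  ⟨F.continuous.measurable, slice_bound F _⟩

lemma Dom.mono {G G' : ℝ × V → ℂ} (hG : Dom G) (hm : Measurable G')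
    (h : ∀ p, ‖G' p‖ ≤ ‖G p‖) : Dom G' := by
  obtain ⟨_, C, hC, h1⟩ := hG
  exact ⟨hm, C, hC, fun s x => (h _).trans (h1 s x)⟩

lemma Dom.slice_measurable {G : ℝ × V → ℂ} (hG : Dom G) (s : ℝ) :
    Measurable (fun y => G (s, y)) := hG.1.comp measurable_prodMk_left

lemma Dom.integrable {G : ℝ × V → ℂ} (hG : Dom G) (s : ℝ) : Integrable (fun y => G (s, y)) := by
  obtain ⟨hm, C, hC, h⟩ := hG
  refine ((integrable_weight (V := V)).const_mul (C * (1 + s ^ 2)⁻¹)).mono'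
    (hm.comp measurable_prodMk_left).aestronglyMeasurable ?_
  refine Filter.Eventually.of_forall (fun x => (h s x).trans (le_of_eq (by ring)))

lemma memLp_weight (p : ℝ≥0∞) (hp : 1 ≤ p) :
    MemLp (fun x : V => ((1 + ‖x‖) ^ (Module.finrank ℝ V + 1))⁻¹) p volume := by
  have h1 : MemLp (fun x : V => ((1 + ‖x‖) ^ (Module.finrank ℝ V + 1))⁻¹) 1 volume :=
    memLp_one_iff_integrable.2 integrable_weight
  have h2 : MemLp (fun x : V => ((1 + ‖x‖) ^ (Module.finrank ℝ V + 1))⁻¹) ∞ volume := by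
    refine memLp_top_of_bound h1.1 1 (Filter.Eventually.of_forall (fun x => ?_))
    rw [norm_inv, norm_pow, Real.norm_of_nonneg (by positivity)]
    exact inv_le_one_of_one_le₀ (one_le_pow₀ (by linarith [norm_nonneg x]))
  rcases eq_or_ne p ∞ with rfl | hp'
  · exact h2
  have hp0 : p ≠ 0 := (zero_lt_one.trans_le hp).ne'
  refine ⟨h1.1, ?_⟩
  rw [eLpNorm_lt_top_iff_lintegral_rpow_enorm_lt_top hp0 hp']
  have h3 := h1.2
  rw [eLpNorm_one_eq_lintegral_enorm] at h3
  refine lt_of_le_of_lt (lintegral_mono (fun x => ?_)) h3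
  have hx : ‖((1 + ‖x‖) ^ (Module.finrank ℝ V + 1))⁻¹‖ₑ ≤ 1 := by
    rw [← ofReal_norm, ← ENNReal.ofReal_one]
    refine ENNReal.ofReal_le_ofReal ?_
    rw [norm_inv, norm_pow, Real.norm_of_nonneg (by positivity)]
    exact inv_le_one_of_one_le₀ (one_le_pow₀ (by linarith [norm_nonneg x]))
  have hp1 : 1 ≤ p.toReal := by
    rw [← ENNReal.toReal_one]; exact ENNReal.toReal_mono hp' hp
  exact (ENNReal.rpow_le_rpow_of_exponent_ge hx hp1).trans (le_of_eq (ENNReal.rpow_one _))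

lemma Dom.eLpNorm_le {G : ℝ × V → ℂ} (hG : Dom G) (p : ℝ≥0∞) (hp : 1 ≤ p) :
    ∃ C : ℝ, 0 ≤ C ∧ ∀ s, eLpNorm (fun y => G (s, y)) p volume ≤ ENNReal.ofReal (C * (1 + s ^ 2)⁻¹) := by
  obtain ⟨hm, C, hC, h⟩ := hG
  have hw := memLp_weight (V := V) p hp
  refine ⟨C * (eLpNorm (fun x : V => ((1 + ‖x‖) ^ (Module.finrank ℝ V + 1))⁻¹) p volume).toReal,
    by positivity, fun s => ?_⟩
  have h1 : eLpNorm (fun y => G (s, y)) p volume ≤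
      eLpNorm ((C * (1 + s ^ 2)⁻¹) • fun x : V => ((1 + ‖x‖) ^ (Module.finrank ℝ V + 1))⁻¹) p volume := by
    refine eLpNorm_mono_real (fun x => (h s x).trans (le_of_eq ?_))
    simp only [Pi.smul_apply, smul_eq_mul]; ring
  rw [eLpNorm_const_smul] at h1
  refine h1.trans (le_of_eq ?_)
  have hnn : 0 ≤ C * (1 + s ^ 2)⁻¹ := by positivity
  rw [Real.enorm_eq_ofReal hnn, mul_right_comm, ENNReal.ofReal_mul hnn, ENNReal.ofReal_toReal hw.2.ne]

lemma Dom.memLp {G : ℝ × V → ℂ} (hG : Dom G) (p : ℝ≥0∞) (hp : 1 ≤ p) (s : ℝ) :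
    MemLp (fun y => G (s, y)) p volume := by
  obtain ⟨C, hC, h⟩ := hG.eLpNorm_le p hp
  exact ⟨(hG.slice_measurable s).aestronglyMeasurable, (h s).trans_lt ENNReal.ofReal_lt_top⟩

lemma Dom.pft_eLpNorm_le {G : ℝ × V → ℂ} (hG : Dom G) (s : ℝ) :
    eLpNorm (pft G s) 2 volume ≤ eLpNorm (fun y => G (s, y)) 2 volume := by
  refine le_trans (le_of_eq ?_) (ft_eLpNorm_le (hG.integrable s))
  exact eLpNorm_congr_norm_ae (Filter.Eventually.of_forall (fun ξ => pft_norm G s ξ))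

lemma Dom.pft_memLp {G : ℝ × V → ℂ} (hG : Dom G) (s : ℝ) : MemLp (pft G s) 2 volume := by
  refine ⟨((pft_measurable hG.1).comp measurable_prodMk_left).aestronglyMeasurable, ?_⟩
  exact (hG.pft_eLpNorm_le s).trans_lt (hG.memLp 2 (by norm_num) s).2

open Classical in
/-- `V(s) G(s)` as an `L²` element on the Fourier side. -/
def ev (G : ℝ × V → ℂ) (s : ℝ) : Lp ℂ 2 (volume : Measure V) :=
  if h : MemLp (pft G s) 2 volume then h.toLp else 0

lemma Dom.ev_eq {G : ℝ × V → ℂ} (hG : Dom G) (s : ℝ) : ev G s = (hG.pft_memLp s).toLp := by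
  rw [ev, dif_pos (hG.pft_memLp s)]

lemma Dom.ev_coe {G : ℝ × V → ℂ} (hG : Dom G) (s : ℝ) : ev G s =ᵐ[volume] pft G s := by
  rw [hG.ev_eq]; exact (hG.pft_memLp s).coeFn_toLp

lemma Dom.ev_enorm_le {G : ℝ × V → ℂ} (hG : Dom G) (s : ℝ) :
    ‖ev G s‖ₑ ≤ eLpNorm (fun y => G (s, y)) 2 volume := by
  rw [hG.ev_eq, Lp.enorm_toLp]
  exact hG.pft_eLpNorm_le s

lemma Dom.ev_stronglyMeasurable {G : ℝ × V → ℂ} (hG : Dom G) : StronglyMeasurable (ev G) := by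
  have : Fact ((2 : ℝ≥0∞) ≠ ∞) := ⟨by simp⟩
  refine stronglyMeasurable_of_edist (fun a => ?_)
  have ha : Measurable (a : V → ℂ) := (Lp.stronglyMeasurable a).measurable
  have h1 : ∀ s, edist (ev G s) a = (∫⁻ ξ, ‖pft G s ξ - a ξ‖ₑ ^ 2) ^ (1 / (2 : ℝ)) := by
    intro s
    rw [Lp.edist_def, eLpNorm_congr_ae ((hG.ev_coe s).sub (Filter.EventuallyEq.refl _ _)),
      eLpNorm_eq_lintegral_rpow_enorm_toReal (by simp) (by simp)]
    simp
  simp_rw [h1]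
  refine Measurable.pow_const ?_ _
  refine Measurable.lintegral_prod_right' (f := fun p : ℝ × V => ‖pft G p.1 p.2 - a p.2‖ₑ ^ 2) ?_
  exact (((pft_measurable hG.1).sub (ha.comp measurable_snd)).enorm).pow_const 2

lemma Dom.ev_integrable {G : ℝ × V → ℂ} (hG : Dom G) : Integrable (ev G) := by
  obtain ⟨C, hC, h⟩ := hG.eLpNorm_le 2 (by norm_num)
  refine (integrable_inv_one_add_sq.const_mul C).mono' hG.ev_stronglyMeasurable.aestronglyMeasurable ?_
  refine Filter.Eventually.of_forall (fun s => ?_)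
  have h1 := (hG.ev_enorm_le s).trans (h s)
  rw [← ofReal_norm] at h1
  exact (ENNReal.ofReal_le_ofReal_iff (by positivity)).1 h1

lemma Dom.ev_inner {G G' : ℝ × V → ℂ} (hG : Dom G) (hG' : Dom G') {s t : ℝ} (hst : s ≠ t) :
    ‖inner ℂ (ev G s) (ev G' t)‖ ≤ |t - s| ^ (-((Module.finrank ℝ V : ℝ) / 2)) *
      ((∫ x, ‖G (s, x)‖) * ∫ x, ‖G' (t, x)‖) := by
  rw [L2.inner_def]
  have h1 : ∫ ξ, inner ℂ (ev G s ξ) (ev G' t ξ) =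
      ∫ ξ, cexp ((4 * Real.pi ^ 2 * (t - s) * ‖ξ‖ ^ 2 : ℝ) * I) *
        (starRingEnd ℂ (𝓕 (fun y => G (s, y)) ξ) * 𝓕 (fun y => G' (t, y)) ξ) := by
    apply integral_congr_ae
    filter_upwards [hG.ev_coe s, hG'.ev_coe t] with ξ h1 h2
    rw [h1, h2, RCLike.inner_apply, pft, pft, map_mul, ← Complex.exp_conj, map_mul, Complex.conj_I,
      Complex.conj_ofReal]
    rw [show ((4 * Real.pi ^ 2 * (t - s) * ‖ξ‖ ^ 2 : ℝ) : ℂ) * I =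
      ((4 * Real.pi ^ 2 * t * ‖ξ‖ ^ 2 : ℝ) : ℂ) * I + ((4 * Real.pi ^ 2 * s * ‖ξ‖ ^ 2 : ℝ) : ℂ) * -I by
        push_cast; ring, Complex.exp_add]
    ring
  rw [h1]
  have hpi := Real.pi_pos
  have hts : t - s ≠ 0 := sub_ne_zero.2 hst.symm
  have hts' : 0 < |t - s| := abs_pos.2 hts
  refine (dispersive (hG.integrable s) (hG'.integrable t) (hG.memLp 2 (by norm_num) s)
    (hG'.memLp 2 (by norm_num) t) (τ := 4 * Real.pi ^ 2 * (t - s)) (by positivity)).trans ?_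
  have hnn : 0 ≤ (∫ x, ‖G (s, x)‖) * ∫ x, ‖G' (t, x)‖ :=
    mul_nonneg (integral_nonneg fun _ => norm_nonneg _) (integral_nonneg fun _ => norm_nonneg _)
  refine mul_le_mul_of_nonneg_right ?_ hnn
  rw [Real.rpow_neg hts'.le, ← Real.inv_rpow hts'.le]
  refine Real.rpow_le_rpow (by positivity) ?_ (by positivity)
  rw [abs_mul, abs_of_pos (by positivity : 0 < 4 * Real.pi ^ 2), inv_eq_one_div,
    div_le_div_iff₀ (by positivity) hts']
  have := Real.pi_gt_three
  nlinarith [mul_pos hpi hts']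

lemma Dom.add {G G' : ℝ × V → ℂ} (hG : Dom G) (hG' : Dom G') : Dom (fun p => G p + G' p) := by
  obtain ⟨hm, C, hC, h⟩ := hG
  obtain ⟨hm', C', hC', h'⟩ := hG'
  refine ⟨hm.add hm', C + C', by positivity, fun s x => (norm_add_le _ _).trans ?_⟩
  rw [add_mul]
  exact add_le_add (h s x) (h' s x)

lemma Dom.ev_add {G G' : ℝ × V → ℂ} (hG : Dom G) (hG' : Dom G') (s : ℝ) :
    ev (fun p => G p + G' p) s = ev G s + ev G' s := by
  rw [hG.ev_eq, hG'.ev_eq, (hG.add hG').ev_eq, ← MemLp.toLp_add]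
  congr 1
  ext ξ
  simp only [pft, Pi.add_apply]
  rw [← mul_add]
  congr 1
  simp only [Real.fourier_eq, smul_add]
  apply integral_add
  · exact (Real.fourierIntegral_convergent_iff ξ).2 (hG.integrable s)
  · exact (Real.fourierIntegral_convergent_iff ξ).2 (hG'.integrable s)

lemma dom_zero : Dom (fun _ : ℝ × V => (0 : ℂ)) :=
  ⟨measurable_const, 0, le_rfl, fun s x => by simp⟩

lemma ev_zero (s : ℝ) : ev (fun _ : ℝ × V => (0 : ℂ)) s = 0 := by
  rw [dom_zero.ev_eq]
  have : pft (fun _ : ℝ × V => (0 : ℂ)) s = 0 := by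
    ext ξ; simp [pft, Real.fourier_eq']
  simp_rw [this]
  exact MemLp.toLp_zero _

lemma dom_sum {ι : Type*} (S : Finset ι) {G : ι → ℝ × V → ℂ} (hG : ∀ i, Dom (G i)) :
    Dom (fun p => ∑ i ∈ S, G i p) ∧ ∀ s, ev (fun p => ∑ i ∈ S, G i p) s = ∑ i ∈ S, ev (G i) s := by
  classical
  induction S using Finset.induction_on with
  | empty => exact ⟨by simpa using dom_zero, fun s => by simpa using ev_zero s⟩
  | insert a S ha ih =>
    simp only [Finset.sum_insert ha]
    refine ⟨(hG a).add ih.1, fun s => ?_⟩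
    rw [(hG a).ev_add ih.1, ih.2]

lemma ev_integral_coe (F : 𝓢(ℝ × V, ℂ)) :
    eLpNorm (fun ξ : V => ∫ s : ℝ, pft F s ξ) 2 volume = ‖∫ s, ev (F : ℝ × V → ℂ) s‖ₑ := by
  have hF := dom_schwartz F
  have hI := pft_integrable F
  rw [Lp.enorm_def]
  refine eLpNorm_congr_ae ?_
  refine ae_eq_of_forall_setIntegral_eq_of_sigmaFinite ?_ ?_ ?_
  · intro A hA hμA
    exact hI.integral_prod_right.integrableOn
  · intro A hA hμA
    exact integrableOn_Lp_of_measure_ne_top _ (by norm_num) hμA.ne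
  · intro A hA hμA
    have h1 := L2.inner_indicatorConstLp_one (𝕜 := ℂ) hA hμA.ne (∫ s, ev (F : ℝ × V → ℂ) s)
    rw [← h1, ← integral_inner hF.ev_integrable]
    rw [integral_integral_swap]
    · congr 1; ext s
      rw [L2.inner_indicatorConstLp_one]
      exact integral_congr_ae (ae_restrict_of_ae ((hF.ev_coe s).symm))
    · refine hI.swap.mono_measure ?_
      have := Measure.prod_restrict (μ := (volume : Measure V)) (ν := (volume : Measure ℝ)) A Set.univ
      rw [Measure.restrict_univ] at this
      rw [this]
      exact Measure.restrict_le_self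

end LpPart

lemma young_pointwise (K a b : ℝ≥0∞) {p q : ℝ} (hq : 2 ≤ q) (hpq : p.HolderConjugate q) :
    K * a * b = (a ^ p * b ^ p) ^ (1 - 2 / q) * ((K ^ (q / 2) * a ^ p) ^ (1 / q) *
      (K ^ (q / 2) * b ^ p) ^ (1 / q)) := by
  have hq0 : 0 < q := by linarith
  have hp0 := hpq.pos
  have h1 : 0 ≤ 1 - 2 / q := by rw [sub_nonneg, div_le_one hq0]; exact hq
  have h2 : 0 ≤ 1 / q := by positivity
  have hpp : p * (1 - 1 / q) = 1 := by
    have := hpq.inv_add_inv_eq_one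
    field_simp at this ⊢
    linarith
  rw [ENNReal.mul_rpow_of_nonneg _ _ h1, ENNReal.mul_rpow_of_nonneg _ _ h2,
    ENNReal.mul_rpow_of_nonneg _ _ h2]
  simp only [← ENNReal.rpow_mul]
  have hK : K = K ^ (q / 2 * (1 / q)) * K ^ (q / 2 * (1 / q)) := by
    rw [← ENNReal.rpow_add_of_nonneg _ _ (by positivity) (by positivity)]
    conv_lhs => rw [← ENNReal.rpow_one K]
    congr 1; field_simp; norm_num
  have ha : ∀ a : ℝ≥0∞, a = a ^ (p * (1 - 2 / q)) * a ^ (p * (1 / q)) := by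
    intro a
    rw [← ENNReal.rpow_add_of_nonneg _ _ (by positivity) (by positivity)]
    conv_lhs => rw [← ENNReal.rpow_one a]
    congr 1; linear_combination -hpp
  conv_lhs => rw [hK, ha a, ha b]
  ring

lemma young_bilin {K a b : ℝ → ℝ≥0∞} (hK : Measurable K) (ha : Measurable a) (hb : Measurable b)
    {p q : ℝ} (hq : 2 ≤ q) (hpq : p.HolderConjugate q) :
    ∫⁻ t, ∫⁻ s, K (t - s) * a s * b t ≤ (∫⁻ τ, K τ ^ (q / 2)) ^ (2 / q) *
      ((∫⁻ s, a s ^ p) ^ (1 / p) * (∫⁻ t, b t ^ p) ^ (1 / p)) := by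
  have hq0 : 0 < q := by linarith
  have hp0 := hpq.pos
  have h1 : 0 ≤ 1 - 2 / q := by rw [sub_nonneg, div_le_one hq0]; exact hq
  have h2 : 0 ≤ 1 / q := by positivity
  have hsum : (1 - 1 / q) = 1 / p := by
    have := hpq.inv_add_inv_eq_one
    rw [one_div, one_div]; linarith
  set A := ∫⁻ s, a s ^ p
  set B := ∫⁻ t, b t ^ p
  set κ := ∫⁻ τ, K τ ^ (q / 2)
  have m1 : Measurable (fun z : ℝ × ℝ => a z.2 ^ p * b z.1 ^ p) := by fun_prop
  have m2 : Measurable (fun z : ℝ × ℝ => K (z.1 - z.2) ^ (q / 2) * a z.2 ^ p) := by fun_prop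
  have m3 : Measurable (fun z : ℝ × ℝ => K (z.1 - z.2) ^ (q / 2) * b z.1 ^ p) := by fun_prop
  have i1 : ∫⁻ z : ℝ × ℝ, a z.2 ^ p * b z.1 ^ p = A * B := by
    rw [Measure.volume_eq_prod, lintegral_prod _ m1.aemeasurable]
    simp only
    simp_rw [lintegral_mul_const'' _ (ha.pow_const p).aemeasurable]
    rw [lintegral_const_mul'' _ (hb.pow_const p).aemeasurable]
  have i2 : ∫⁻ z : ℝ × ℝ, K (z.1 - z.2) ^ (q / 2) * a z.2 ^ p = κ * A := by
    rw [Measure.volume_eq_prod, lintegral_prod_symm _ m2.aemeasurable]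
    simp only
    have : ∀ y, ∫⁻ x, K (x - y) ^ (q / 2) * a y ^ p = κ * a y ^ p := by
      intro y
      rw [lintegral_mul_const'' _ (by fun_prop), lintegral_sub_right_eq_self (fun x => K x ^ (q / 2))]
    simp_rw [this]
    rw [lintegral_const_mul'' _ (ha.pow_const p).aemeasurable]
  have i3 : ∫⁻ z : ℝ × ℝ, K (z.1 - z.2) ^ (q / 2) * b z.1 ^ p = κ * B := by
    rw [Measure.volume_eq_prod, lintegral_prod _ m3.aemeasurable]
    simp only
    have : ∀ y, ∫⁻ x, K (y - x) ^ (q / 2) * b y ^ p = κ * b y ^ p := by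
      intro y
      rw [lintegral_mul_const'' _ (by fun_prop), lintegral_sub_left_eq_self (fun x => K x ^ (q / 2))]
    simp_rw [this]
    rw [lintegral_const_mul'' _ (hb.pow_const p).aemeasurable]
  have hH := ENNReal.lintegral_prod_norm_pow_le (μ := (volume : Measure (ℝ × ℝ))) (Finset.univ : Finset (Fin 3))
    (f := ![fun z : ℝ × ℝ => a z.2 ^ p * b z.1 ^ p, fun z => K (z.1 - z.2) ^ (q / 2) * a z.2 ^ p,
      fun z => K (z.1 - z.2) ^ (q / 2) * b z.1 ^ p])
    (by intro i _; fin_cases i; exacts [m1.aemeasurable, m2.aemeasurable, m3.aemeasurable])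
    (p := ![1 - 2 / q, 1 / q, 1 / q]) (by simp [Fin.sum_univ_three]; ring)
    (by intro i _; fin_cases i; exacts [h1, h2, h2])
  simp only [Fin.prod_univ_three, Matrix.cons_val_zero, Matrix.cons_val_one, Matrix.cons_val_two,
    Matrix.head_cons, Matrix.tail_cons, i1, i2, i3] at hH
  have m0 : Measurable (fun z : ℝ × ℝ => K (z.1 - z.2) * a z.2 * b z.1) := by fun_prop
  have e0 : ∫⁻ t, ∫⁻ s, K (t - s) * a s * b t = ∫⁻ z : ℝ × ℝ, K (z.1 - z.2) * a z.2 * b z.1 := by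
    rw [Measure.volume_eq_prod, lintegral_prod _ m0.aemeasurable]
  rw [e0]
  calc _ = ∫⁻ z : ℝ × ℝ, (a z.2 ^ p * b z.1 ^ p) ^ (1 - 2 / q) *
          (K (z.1 - z.2) ^ (q / 2) * a z.2 ^ p) ^ (1 / q) *
          (K (z.1 - z.2) ^ (q / 2) * b z.1 ^ p) ^ (1 / q) := by
        congr 1; ext z; rw [young_pointwise _ _ _ hq hpq]; ring
    _ ≤ _ := hH
    _ = _ := by
        rw [ENNReal.mul_rpow_of_nonneg _ _ h1, ENNReal.mul_rpow_of_nonneg _ _ h2,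
          ENNReal.mul_rpow_of_nonneg _ _ h2]
        have e1 : κ ^ (2 / q) = κ ^ (1 / q) * κ ^ (1 / q) := by
          rw [← ENNReal.rpow_add_of_nonneg _ _ h2 h2]; congr 1; ring
        have e2 : ∀ A : ℝ≥0∞, A ^ (1 / p) = A ^ (1 - 2 / q) * A ^ (1 / q) := by
          intro A
          rw [← ENNReal.rpow_add_of_nonneg _ _ h1 h2, ← hsum]; congr 1; ring
        rw [e1, e2 A, e2 B]
        ring

/-- truncated tail kernel -/
def tailK (σ ρ : ℝ) (τ : ℝ) : ℝ≥0∞ := if |τ| ≤ ρ then 0 else ENNReal.ofReal (|τ| ^ (-σ))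

lemma tailK_measurable (σ ρ : ℝ) : Measurable (tailK σ ρ) := by
  unfold tailK
  refine Measurable.ite (measurableSet_le (by fun_prop) measurable_const) measurable_const ?_
  fun_prop

lemma lintegral_even_tail {h : ℝ → ℝ≥0∞} (ρ : ℝ) (hρ : 0 ≤ ρ) (h0 : ∀ τ, |τ| ≤ ρ → h τ = 0)
    (hev : ∀ τ, h (-τ) = h τ) : ∫⁻ τ, h τ = 2 * ∫⁻ τ in Set.Ioi ρ, h τ := by
  have h1 : ∫⁻ τ in Set.Iio (-ρ), h τ = ∫⁻ τ in Set.Ioi ρ, h τ := by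
    have := (Measure.measurePreserving_neg (volume : Measure ℝ)).setLIntegral_comp_emb
      (MeasurableEquiv.neg ℝ).measurableEmbedding h (Set.Ioi ρ)
    rw [Set.image_neg_eq_neg, Set.neg_Ioi] at this
    rw [← this]
    simp_rw [hev]
  rw [two_mul]
  nth_rewrite 1 [← h1]
  have hd : Disjoint (Set.Iio (-ρ)) (Set.Ioi ρ) := by
    rw [Set.disjoint_left]; intro x hx hx'
    simp only [Set.mem_Iio, Set.mem_Ioi] at hx hx'; linarith
  rw [← lintegral_union measurableSet_Ioi hd,
    ← lintegral_add_compl h (measurableSet_Iio.union measurableSet_Ioi : MeasurableSet (Set.Iio (-ρ) ∪ Set.Ioi ρ))]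
  have h2 : ∫⁻ τ in (Set.Iio (-ρ) ∪ Set.Ioi ρ)ᶜ, h τ = 0 := by
    rw [setLIntegral_congr_fun (g := fun _ => 0) (measurableSet_Iio.union measurableSet_Ioi).compl]
    · simp
    · intro τ hτ
      simp only [Set.compl_union, Set.mem_inter_iff, Set.mem_compl_iff, Set.mem_Iio, Set.mem_Ioi, not_lt] at hτ
      exact h0 τ (abs_le.2 hτ)
  rw [h2, add_zero]

lemma tailK_lintegral {σ q ρ : ℝ} (hρ : 0 < ρ) (hq : 0 < q) (h : 1 < σ * (q / 2)) :
    (∫⁻ τ, tailK σ ρ τ ^ (q / 2)) ^ (2 / q) =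
      ENNReal.ofReal ((2 / (σ * (q / 2) - 1)) ^ (2 / q) * ρ ^ (2 / q - σ)) := by
  have hσ0 : 0 < σ * (q / 2) - 1 := by linarith
  rw [lintegral_even_tail ρ hρ.le]
  · have h1 : ∫⁻ τ in Set.Ioi ρ, tailK σ ρ τ ^ (q / 2) =
        ∫⁻ τ in Set.Ioi ρ, ENNReal.ofReal (τ ^ (-(σ * (q / 2)))) := by
      refine setLIntegral_congr_fun measurableSet_Ioi (fun τ hτ => ?_)
      have hτ' : ρ < τ := hτ
      have hτ0 : 0 < τ := hρ.trans hτ'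
      simp only [tailK, abs_of_pos hτ0, not_le.2 hτ', if_false]
      rw [ENNReal.ofReal_rpow_of_nonneg (by positivity) (by positivity), ← Real.rpow_mul hτ0.le]
      ring_nf
    rw [h1, ← ofReal_integral_eq_lintegral_ofReal (integrableOn_Ioi_rpow_of_lt (by linarith) hρ),
      integral_Ioi_rpow_of_lt (by linarith) hρ]
    · rw [show (2 : ℝ≥0∞) = ENNReal.ofReal 2 by simp, ← ENNReal.ofReal_mul (by norm_num),
        ENNReal.ofReal_rpow_of_nonneg _ (by positivity)]
      · congr 1
        rw [show 2 * (-ρ ^ (-(σ * (q / 2)) + 1) / (-(σ * (q / 2)) + 1)) =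
          (2 / (σ * (q / 2) - 1)) * ρ ^ (-(σ * (q / 2)) + 1) by
            rw [show -(σ * (q / 2)) + 1 = -(σ * (q / 2) - 1) by ring]; field_simp,
          Real.mul_rpow (by positivity) (by positivity), ← Real.rpow_mul hρ.le]
        congr 2
        field_simp
        ring
      · rw [show -(σ * (q / 2)) + 1 = -(σ * (q / 2) - 1) by ring, neg_div_neg_eq]
        positivity
    · refine (ae_restrict_mem measurableSet_Ioi).mono (fun τ hτ => ?_)
      have : 0 < τ := hρ.trans hτ
      simp only [Pi.zero_apply]; positivity
  · intro τ hτ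
    rw [tailK, if_pos hτ, ENNReal.zero_rpow_of_pos (by positivity)]
  · intro τ
    simp only [tailK, abs_neg]

/-- near kernel -/
def nearK (ρ : ℝ) (τ : ℝ) : ℝ≥0∞ := if |τ| ≤ ρ then 1 else 0

lemma nearK_measurable (ρ : ℝ) : Measurable (nearK ρ) := by
  unfold nearK
  exact Measurable.ite (measurableSet_le (by fun_prop) measurable_const) measurable_const measurable_const

lemma nearK_lintegral {e ρ : ℝ} (he : 0 < e) :
    ∫⁻ τ, nearK ρ τ ^ e = ENNReal.ofReal (2 * ρ) := by
  have h1 : ∀ τ, nearK ρ τ ^ e = (Set.Icc (-ρ) ρ).indicator (fun _ => 1) τ := by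
    intro τ
    by_cases hτ : |τ| ≤ ρ
    · rw [nearK, if_pos hτ, Set.indicator_of_mem (Set.mem_Icc.2 (abs_le.1 hτ)), ENNReal.one_rpow]
    · rw [nearK, if_neg hτ, Set.indicator_of_notMem (fun h => hτ (abs_le.2 (Set.mem_Icc.1 h))), ENNReal.zero_rpow_of_pos he]
  simp_rw [h1]
  rw [lintegral_indicator measurableSet_Icc, setLIntegral_one, Real.volume_Icc]
  congr 1; ring

section Bil
variable {H : Type*} [NormedAddCommGroup H] [InnerProductSpace ℂ H] [CompleteSpace H]

lemma enorm_inner_le (u v : H) : ‖inner ℂ u v‖ₑ ≤ ‖u‖ₑ * ‖v‖ₑ := by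
  rw [← ofReal_norm, ← ofReal_norm, ← ofReal_norm, ← ENNReal.ofReal_mul (norm_nonneg _)]
  exact ENNReal.ofReal_le_ofReal (norm_inner_le_norm u v)

lemma enorm_inner_symm (u v : H) : ‖inner ℂ u v‖ₑ = ‖inner ℂ v u‖ₑ := by
  rw [← ofReal_norm, ← ofReal_norm, norm_inner_symm]

lemma enorm_inner_integral_right (u : H) {g : ℝ → H} {μ : Measure ℝ} (hg : Integrable g μ) :
    ‖inner ℂ u (∫ t, g t ∂μ)‖ₑ ≤ ∫⁻ t, ‖inner ℂ u (g t)‖ₑ ∂μ := by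
  rw [← integral_inner hg]
  exact enorm_integral_le_lintegral_enorm _

lemma enorm_inner_integral_left (u : H) {g : ℝ → H} {μ : Measure ℝ} (hg : Integrable g μ) :
    ‖inner ℂ (∫ t, g t ∂μ) u‖ₑ ≤ ∫⁻ t, ‖inner ℂ (g t) u‖ₑ ∂μ := by
  rw [enorm_inner_symm]
  refine (enorm_inner_integral_right u hg).trans (le_of_eq ?_)
  congr 1; ext t; rw [enorm_inner_symm]

lemma enorm_sq_eq (u : H) : ‖u‖ₑ ^ 2 = ‖inner ℂ u u‖ₑ := by
  rw [← ofReal_norm, ← ofReal_norm, inner_self_eq_norm_sq_to_K, ← ENNReal.ofReal_pow (norm_nonneg _)]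
  simp

/-- constant -/
def cTail (σ q : ℝ) : ℝ := (2 / (σ * (q / 2) - 1)) ^ (2 / q)

/-- constant -/
def cSelf (σ q : ℝ) : ℝ := 2 ^ (2 / q) + cTail σ q

lemma self_bound {σ q p γ R : ℝ} (hq : 2 ≤ q) (hpq : p.HolderConjugate q)
    (hγ : γ = σ / 2 - 1 / q) (hγ0 : 0 < γ) (hR : 0 < R) {f : ℝ → H} (hf : Integrable f)
    {a : ℝ → ℝ≥0∞} (ha : Measurable a)
    (h1 : ∀ s, ‖f s‖ₑ ≤ ENNReal.ofReal (R ^ (-(1 / q))) * a s)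
    (h2 : ∀ s t, s ≠ t → ‖inner ℂ (f s) (f t)‖ₑ ≤ ENNReal.ofReal (|t - s| ^ (-σ)) *
      (ENNReal.ofReal (R ^ γ) * a s * (ENNReal.ofReal (R ^ γ) * a t))) :
    ‖∫ s, f s‖ₑ ^ 2 ≤ ENNReal.ofReal (cSelf σ q) * ((∫⁻ s, a s ^ p) ^ (1 / p)) ^ 2 := by
  have hq0 : 0 < q := by linarith
  have hσ : 1 < σ * (q / 2) := by
    have : 0 < σ / 2 - 1 / q := hγ ▸ hγ0
    have := mul_pos this hq0
    field_simp at this ⊢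
    linarith
  have hct : 0 ≤ cTail σ q := by
    unfold cTail
    have : 0 < σ * (q / 2) - 1 := by linarith
    positivity
  rw [enorm_sq_eq]
  set M := ENNReal.ofReal (R ^ (-(1 / q)))
  set N := ENNReal.ofReal (R ^ γ)
  calc _ ≤ ∫⁻ t, ∫⁻ s, ‖inner ℂ (f s) (f t)‖ₑ :=
        (enorm_inner_integral_right _ hf).trans (lintegral_mono (fun t => enorm_inner_integral_left _ hf))
    _ ≤ ∫⁻ t, ∫⁻ s, (M * M * (nearK R (t - s) * a s * a t) + N * N * (tailK σ R (t - s) * a s * a t)) := by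
        refine lintegral_mono (fun t => lintegral_mono (fun s => ?_))
        by_cases hst : |t - s| ≤ R
        · simp only [nearK, tailK, if_pos hst]
          refine (enorm_inner_le _ _).trans ((mul_le_mul' (h1 s) (h1 t)).trans (le_of_eq ?_))
          ring
        · have hne : s ≠ t := by
            rintro rfl; simp at hst; linarith
          simp only [nearK, tailK, if_neg hst]
          refine (h2 s t hne).trans (le_of_eq ?_)
          ring
    _ = M * M * (∫⁻ t, ∫⁻ s, nearK R (t - s) * a s * a t) +
        N * N * ∫⁻ t, ∫⁻ s, tailK σ R (t - s) * a s * a t := by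
        have n1 := nearK_measurable R
        have n2 := tailK_measurable σ R
        have m1 : Measurable (fun z : ℝ × ℝ => nearK R (z.1 - z.2) * a z.2 * a z.1) := by fun_prop
        have m2 : Measurable (fun z : ℝ × ℝ => tailK σ R (z.1 - z.2) * a z.2 * a z.1) := by fun_prop
        have m3 : Measurable (fun t => ∫⁻ s, nearK R (t - s) * a s * a t) := m1.lintegral_prod_right'
        have m4 : Measurable (fun t => ∫⁻ s, tailK σ R (t - s) * a s * a t) := m2.lintegral_prod_right'
        rw [← lintegral_const_mul _ m3, ← lintegral_const_mul _ m4, ← lintegral_add_left (m3.const_mul _)]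
        congr 1; ext t
        rw [← lintegral_const_mul _ (by fun_prop), ← lintegral_const_mul _ (by fun_prop),
          ← lintegral_add_left (by fun_prop)]
    _ ≤ M * M * (ENNReal.ofReal (2 * R) ^ (2 / q) * ((∫⁻ s, a s ^ p) ^ (1 / p) * (∫⁻ s, a s ^ p) ^ (1 / p)))
      + N * N * (ENNReal.ofReal (cTail σ q * R ^ (2 / q - σ)) *
        ((∫⁻ s, a s ^ p) ^ (1 / p) * (∫⁻ s, a s ^ p) ^ (1 / p))) := by
        gcongr
        · refine (young_bilin (nearK_measurable R) ha ha hq hpq).trans (le_of_eq ?_)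
          rw [nearK_lintegral (by positivity)]
        · refine (young_bilin (tailK_measurable σ R) ha ha hq hpq).trans (le_of_eq ?_)
          rw [tailK_lintegral hR hq0 hσ, cTail]
    _ = _ := by
        rw [cSelf, ENNReal.ofReal_add (by positivity) hct]
        have e1 : M * M * ENNReal.ofReal (2 * R) ^ (2 / q) = ENNReal.ofReal (2 ^ (2 / q)) := by
          rw [ENNReal.ofReal_rpow_of_nonneg (by positivity) (by positivity),
            ← ENNReal.ofReal_mul (by positivity), ← ENNReal.ofReal_mul (by positivity),
            Real.mul_rpow (by norm_num) hR.le, ← Real.rpow_add hR, mul_left_comm, ← Real.rpow_add hR]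
          rw [show -(1 / q) + -(1 / q) + 2 / q = 0 by ring]
          simp
        have e2 : N * N * ENNReal.ofReal (cTail σ q * R ^ (2 / q - σ)) = ENNReal.ofReal (cTail σ q) := by
          rw [← ENNReal.ofReal_mul (by positivity), ← ENNReal.ofReal_mul (by positivity),
            ← Real.rpow_add hR, mul_left_comm, ← Real.rpow_add hR]
          rw [show γ + γ + (2 / q - σ) = 0 by rw [hγ]; ring]
          simp
        rw [← e1, ← e2]
        ring

lemma nearK_rpow (ρ τ : ℝ) {e : ℝ} (he : 0 < e) : nearK ρ τ ^ e = nearK ρ τ := by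
  unfold nearK
  split_ifs
  · simp
  · simp [he]

lemma self_bound_near {σ q p γ R : ℝ} (hq : 2 ≤ q) (hpq : p.HolderConjugate q)
    (hγ : γ = σ / 2 - 1 / q) (hγ0 : 0 < γ) (hR : 0 < R) {f : ℝ → H} (hf : Integrable f)
    {a : ℝ → ℝ≥0∞} (ha : Measurable a)
    (h1 : ∀ s, ‖f s‖ₑ ≤ ENNReal.ofReal (R ^ (-(1 / q))) * a s)
    (h2 : ∀ s t, s ≠ t → ‖inner ℂ (f s) (f t)‖ₑ ≤ ENNReal.ofReal (|t - s| ^ (-σ)) *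
      (ENNReal.ofReal (R ^ γ) * a s * (ENNReal.ofReal (R ^ γ) * a t))) (ρ t : ℝ) :
    ‖∫ s in {s | |t - s| ≤ ρ}, f s‖ₑ ≤ ENNReal.ofReal (cSelf σ q) ^ (1 / (2 : ℝ)) *
      (∫⁻ s, nearK ρ (t - s) * a s ^ p) ^ (1 / p) := by
  have hm : MeasurableSet {s | |t - s| ≤ ρ} := measurableSet_le (by fun_prop) measurable_const
  have n1 := nearK_measurable ρ
  have key := self_bound (f := Set.indicator {s | |t - s| ≤ ρ} f) (a := fun s => nearK ρ (t - s) * a s)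
    hq hpq hγ hγ0 hR (hf.indicator hm) (by fun_prop) ?_ ?_
  · rw [integral_indicator hm] at key
    have e1 : ∀ s, (nearK ρ (t - s) * a s) ^ p = nearK ρ (t - s) * a s ^ p := by
      intro s
      rw [ENNReal.mul_rpow_of_nonneg _ _ hpq.pos.le, nearK_rpow _ _ hpq.pos]
    simp_rw [e1] at key
    have := ENNReal.rpow_le_rpow key (by norm_num : (0 : ℝ) ≤ 1 / 2)
    rw [ENNReal.mul_rpow_of_nonneg _ _ (by norm_num), ← ENNReal.rpow_natCast, ← ENNReal.rpow_natCast,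
      ← ENNReal.rpow_mul, ← ENNReal.rpow_mul _ _ (1 / 2)] at this
    norm_num at this ⊢
    exact this
  · intro s
    by_cases hs : |t - s| ≤ ρ
    · rw [Set.indicator_of_mem (show s ∈ {s | |t - s| ≤ ρ} from hs), nearK, if_pos hs, one_mul]; exact h1 s
    · rw [Set.indicator_of_notMem (show s ∉ {s | |t - s| ≤ ρ} from hs)]; simp
  · intro s u hsu
    by_cases hs : |t - s| ≤ ρ
    · by_cases hu : |t - u| ≤ ρ
      · rw [Set.indicator_of_mem (show s ∈ {s | |t - s| ≤ ρ} from hs),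
          Set.indicator_of_mem (show u ∈ {s | |t - s| ≤ ρ} from hu), nearK, if_pos hs,
          nearK, if_pos hu, one_mul, one_mul]
        exact h2 s u hsu
      · rw [Set.indicator_of_notMem (show u ∉ {s | |t - s| ≤ ρ} from hu)]; simp
    · rw [Set.indicator_of_notMem (show s ∉ {s | |t - s| ≤ ρ} from hs)]; simp

lemma near_holder {q p ρ : ℝ} (hq : 2 ≤ q) (hpq : p.HolderConjugate q) 
    {a b : ℝ → ℝ≥0∞} (ha : Measurable a) (hb : Measurable b) :
    ∫⁻ t, (∫⁻ s, nearK ρ (t - s) * a s ^ p) ^ (1 / p) * b t ≤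
      ENNReal.ofReal (2 * ρ) ^ (1 / q) * ((∫⁻ s, a s ^ p) ^ (1 / p) * (∫⁻ t, b t ^ p) ^ (1 / p)) := by
  have hq0 : 0 < q := by linarith
  have hp0 := hpq.pos
  have n1 := nearK_measurable ρ
  have m1 : Measurable (fun z : ℝ × ℝ => nearK ρ (z.1 - z.2) * a z.2 ^ p) := by fun_prop
  have m2 : Measurable (fun t => ∫⁻ s, nearK ρ (t - s) * a s ^ p) := m1.lintegral_prod_right'
  have hpq1 : 0 ≤ q / p - 1 := by
    have : p ≤ 2 := by
      have := hpq.inv_add_inv_eq_one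
      have h3 : q⁻¹ ≤ 2⁻¹ := inv_anti₀ (by norm_num) hq
      have h4 : 2⁻¹ ≤ p⁻¹ := by linarith
      exact (inv_le_inv₀ (by norm_num) hp0).1 h4
    rw [sub_nonneg, le_div_iff₀ hp0]; linarith
  refine (ENNReal.lintegral_mul_le_Lp_mul_Lq volume hpq.symm (m2.pow_const _).aemeasurable
    hb.aemeasurable).trans ?_
  rw [← mul_assoc]
  gcongr
  set X := ∫⁻ s, a s ^ p
  have h1 : ∫⁻ t, ((∫⁻ s, nearK ρ (t - s) * a s ^ p) ^ (1 / p)) ^ q ≤ ENNReal.ofReal (2 * ρ) * X ^ (q / p) := by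
    calc _ ≤ ∫⁻ t, X ^ (q / p - 1) * ∫⁻ s, nearK ρ (t - s) * a s ^ p := by
          refine lintegral_mono (fun t => ?_)
          simp only
          rw [← ENNReal.rpow_mul, show 1 / p * q = (q / p - 1) + 1 by ring,
            ENNReal.rpow_add_of_nonneg _ _ hpq1 zero_le_one, ENNReal.rpow_one]
          gcongr
          refine lintegral_mono (fun s => ?_)
          simp only [nearK]
          split_ifs <;> simp
      _ = X ^ (q / p - 1) * (ENNReal.ofReal (2 * ρ) * X) := by
          rw [lintegral_const_mul _ m2, lintegral_lintegral_swap m1.aemeasurable]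
          congr 1
          have : ∀ s, ∫⁻ t, nearK ρ (t - s) * a s ^ p = ENNReal.ofReal (2 * ρ) * a s ^ p := by
            intro s
            rw [lintegral_mul_const _ (by fun_prop), lintegral_sub_right_eq_self (fun x => nearK ρ x)]
            have := nearK_lintegral (ρ := ρ) (zero_lt_one' ℝ)
            simp only [ENNReal.rpow_one] at this
            rw [this]
          simp_rw [this]
          rw [lintegral_const_mul _ (by fun_prop)]
      _ = _ := by
          nth_rewrite 2 [← ENNReal.rpow_one X]
          rw [mul_left_comm, ← ENNReal.rpow_add_of_nonneg _ _ hpq1 zero_le_one]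
          ring_nf
  calc _ ≤ (ENNReal.ofReal (2 * ρ) * X ^ (q / p)) ^ (1 / q) := by gcongr
    _ = _ := by
      rw [ENNReal.mul_rpow_of_nonneg _ _ (by positivity), ← ENNReal.rpow_mul]
      congr 2; field_simp

lemma cross_bound {σ q p γ R S ρ : ℝ} (hq : 2 ≤ q) (hpq : p.HolderConjugate q)
    (hγ : γ = σ / 2 - 1 / q) (hγ0 : 0 < γ) (hR : 0 < R) (hS : 0 < S) (hρ : 0 < ρ)
    {f g : ℝ → H} (hf : Integrable f) (hg : Integrable g)
    {a b : ℝ → ℝ≥0∞} (ha : Measurable a) (hb : Measurable b)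
    (h1 : ∀ s, ‖f s‖ₑ ≤ ENNReal.ofReal (R ^ (-(1 / q))) * a s)
    (h1' : ∀ s, ‖g s‖ₑ ≤ ENNReal.ofReal (S ^ (-(1 / q))) * b s)
    (h2 : ∀ s t, s ≠ t → ‖inner ℂ (f s) (f t)‖ₑ ≤ ENNReal.ofReal (|t - s| ^ (-σ)) *
      (ENNReal.ofReal (R ^ γ) * a s * (ENNReal.ofReal (R ^ γ) * a t)))
    (h2' : ∀ s t, s ≠ t → ‖inner ℂ (f s) (g t)‖ₑ ≤ ENNReal.ofReal (|t - s| ^ (-σ)) *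
      (ENNReal.ofReal (R ^ γ) * a s * (ENNReal.ofReal (S ^ γ) * b t))) :
    ‖inner ℂ (∫ s, f s) (∫ t, g t)‖ₑ ≤ (ENNReal.ofReal (cSelf σ q) ^ (1 / (2 : ℝ)) *
      ENNReal.ofReal (S ^ (-(1 / q))) * ENNReal.ofReal (2 * ρ) ^ (1 / q) +
      ENNReal.ofReal (R ^ γ) * ENNReal.ofReal (S ^ γ) * ENNReal.ofReal (cTail σ q * ρ ^ (-(2 * γ)))) *
      ((∫⁻ s, a s ^ p) ^ (1 / p) * (∫⁻ t, b t ^ p) ^ (1 / p)) := by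
  have hq0 : 0 < q := by linarith
  have hσ : 1 < σ * (q / 2) := by
    have : 0 < σ / 2 - 1 / q := hγ ▸ hγ0
    have := mul_pos this hq0
    field_simp at this ⊢
    linarith
  have n1 := nearK_measurable ρ
  have n2 := tailK_measurable σ ρ
  set c1 := ENNReal.ofReal (cSelf σ q) ^ (1 / (2 : ℝ))
  set M := ENNReal.ofReal (S ^ (-(1 / q)))
  set N := ENNReal.ofReal (R ^ γ)
  set N' := ENNReal.ofReal (S ^ γ)
  have m0 : Measurable (fun z : ℝ × ℝ => nearK ρ (z.1 - z.2) * a z.2 ^ p) := by fun_prop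
  have m1 : Measurable (fun t => ∫⁻ s, nearK ρ (t - s) * a s ^ p) := m0.lintegral_prod_right'
  have m2 : Measurable (fun z : ℝ × ℝ => tailK σ ρ (z.1 - z.2) * a z.2 * b z.1) := by fun_prop
  have m3 : Measurable (fun t => ∫⁻ s, tailK σ ρ (t - s) * a s * b t) := m2.lintegral_prod_right'
  have hpt : ∀ t, ‖inner ℂ (∫ s, f s) (g t)‖ₑ ≤
      c1 * M * ((∫⁻ s, nearK ρ (t - s) * a s ^ p) ^ (1 / p) * b t) +
      N * N' * ∫⁻ s, tailK σ ρ (t - s) * a s * b t := by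
    intro t
    have hm : MeasurableSet {s | |t - s| ≤ ρ} := measurableSet_le (by fun_prop) measurable_const
    rw [← integral_add_compl hm hf, inner_add_left]
    refine (enorm_add_le _ _).trans (add_le_add ?_ ?_)
    · refine (enorm_inner_le _ _).trans ((mul_le_mul' (self_bound_near hq hpq hγ hγ0 hR hf ha h1 h2 ρ t)
        (h1' t)).trans (le_of_eq ?_))
      ring
    · refine (enorm_inner_integral_left _ hf.integrableOn).trans ?_
      rw [← lintegral_indicator hm.compl, ← lintegral_const_mul _ (by fun_prop)]
      refine lintegral_mono (fun s => ?_)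
      by_cases hs : |t - s| ≤ ρ
      · rw [Set.indicator_of_notMem (by simpa using hs)]; simp
      · rw [Set.indicator_of_mem (by simpa using hs), tailK, if_neg hs]
        refine (h2' s t ?_).trans (le_of_eq (by ring))
        rintro rfl; simp at hs; linarith
  refine (enorm_inner_integral_right _ hg).trans ((lintegral_mono hpt).trans ?_)
  rw [lintegral_add_left (by fun_prop), lintegral_const_mul _ (by fun_prop), lintegral_const_mul _ m3, add_mul]
  refine add_le_add ?_ ?_
  · rw [mul_assoc (c1 * M)]
    gcongr
    exact near_holder hq hpq ha hb
  · rw [mul_assoc (N * N')]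
    gcongr
    refine (young_bilin n2 ha hb hq hpq).trans (le_of_eq ?_)
    rw [tailK_lintegral hρ hq0 hσ, cTail, show 2 / q - σ = -(2 * γ) by rw [hγ]; ring]

end Bil

lemma tsum_rpow_le (v : ℤ → ℝ≥0∞) {e : ℝ} (he : 1 ≤ e) : ∑' k, v k ^ e ≤ (∑' k, v k) ^ e := by
  have h0 : 0 ≤ e - 1 := by linarith
  have h1 : ∀ x : ℝ≥0∞, x ^ e = x * x ^ (e - 1) := by
    intro x
    conv_rhs => enter [1]; rw [← ENNReal.rpow_one x]
    rw [← ENNReal.rpow_add_of_nonneg _ _ zero_le_one h0]; ring_nf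
  rw [h1 (∑' k, v k), ← ENNReal.tsum_mul_right]
  refine ENNReal.tsum_le_tsum (fun k => ?_)
  rw [h1]
  gcongr
  exact ENNReal.le_tsum k

lemma tsum_geom_int {θ : ℝ≥0∞} (hθ : θ < 1) : ∑' m : ℤ, θ ^ m.natAbs ≠ ∞ := by
  have h : ∑' m : ℤ, θ ^ m.natAbs ≤ (∑' n : ℕ, θ ^ n) + ∑' n : ℕ, θ ^ n := by
    have h1 : ∀ m : ℤ, θ ^ m.natAbs ≤ 
        (∑' n : ℕ, if (n : ℤ) = m then θ ^ n else 0) + ∑' n : ℕ, if (-n : ℤ) = m then θ ^ n else 0 := by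
      intro m
      rcases Int.natAbs_eq m with hm | hm
      · refine le_trans ?_ (le_add_right (ENNReal.le_tsum m.natAbs))
        rw [if_pos hm.symm]
      · refine le_trans ?_ (le_add_left (ENNReal.le_tsum m.natAbs))
        rw [if_pos hm.symm]
    refine (ENNReal.tsum_le_tsum h1).trans ?_
    rw [ENNReal.tsum_add]
    refine add_le_add ?_ ?_
    · rw [ENNReal.tsum_comm]
      refine ENNReal.tsum_le_tsum (fun n => ?_)
      rw [tsum_ite_eq']
    · rw [ENNReal.tsum_comm]
      refine ENNReal.tsum_le_tsum (fun n => ?_)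
      rw [tsum_ite_eq']
  refine ne_top_of_le_ne_top ?_ h
  rw [ENNReal.tsum_geometric]
  have : (1 - θ)⁻¹ ≠ ∞ := by
    rw [ENNReal.inv_ne_top]; exact (tsub_pos_of_lt hθ).ne'
  exact ENNReal.add_ne_top.2 ⟨this, this⟩

lemma mul_le_sq_add_sq (x y : ℝ≥0∞) : x * y ≤ x ^ 2 + y ^ 2 := by
  rcases le_total x y with h | h
  · refine le_trans ?_ le_add_self; rw [sq]; gcongr
  · refine le_trans ?_ le_self_add; rw [sq]; gcongr

lemma schur_tsum (θ : ℝ≥0∞) (A : ℤ → ℝ≥0∞) :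
    ∑' k : ℤ, ∑' l : ℤ, θ ^ (k - l).natAbs * (A k * A l) ≤
      2 * (∑' m : ℤ, θ ^ m.natAbs) * ∑' k, A k ^ 2 := by
  set Θ := ∑' m : ℤ, θ ^ m.natAbs
  have h1 : ∀ k : ℤ, ∑' l : ℤ, θ ^ (k - l).natAbs = Θ := fun k =>
    (Equiv.subLeft k).tsum_eq (fun m : ℤ => θ ^ m.natAbs)
  have h2 : ∀ l : ℤ, ∑' k : ℤ, θ ^ (k - l).natAbs = Θ := fun l =>
    (Equiv.subRight l).tsum_eq (fun m : ℤ => θ ^ m.natAbs)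
  calc _ ≤ ∑' k : ℤ, ∑' l : ℤ, (θ ^ (k - l).natAbs * A k ^ 2 + θ ^ (k - l).natAbs * A l ^ 2) := by
        refine ENNReal.tsum_le_tsum (fun k => ENNReal.tsum_le_tsum (fun l => ?_))
        rw [← mul_add]
        gcongr
        exact mul_le_sq_add_sq _ _
    _ = Θ * (∑' k, A k ^ 2) + Θ * ∑' k, A k ^ 2 := by
        simp_rw [ENNReal.tsum_add]
        congr 1
        · simp_rw [ENNReal.tsum_mul_right, h1, ENNReal.tsum_mul_left]
        · rw [ENNReal.tsum_comm]
          simp_rw [ENNReal.tsum_mul_right, h2, ENNReal.tsum_mul_left]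
    _ = _ := by ring

lemma minkowski_finset {X : Type*} [MeasurableSpace X] {μ : Measure X} (S : Finset ℤ) {u : ℤ → X → ℝ≥0∞}
    (hu : ∀ k, Measurable (u k)) {m : ℝ} (hm : 1 ≤ m) :
    ∑ k ∈ S, (∫⁻ x, u k x ∂μ) ^ m ≤ (∫⁻ x, (∑ k ∈ S, u k x ^ m) ^ (1 / m) ∂μ) ^ m := by
  have hm0 : 0 < m := by linarith
  rcases hm.eq_or_lt with rfl | hm1
  · simp only [ENNReal.rpow_one, div_one]
    rw [lintegral_finsetSum _ (fun k _ => hu k)]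
  set Y := ∑ k ∈ S, (∫⁻ x, u k x ∂μ) ^ m
  set Z := ∫⁻ x, (∑ k ∈ S, u k x ^ m) ^ (1 / m) ∂μ
  have hk : ∀ k ∈ S, ∫⁻ x, u k x ∂μ ≤ Z := by
    intro k hk
    refine lintegral_mono (fun x => ?_)
    calc u k x = (u k x ^ m) ^ (1 / m) := by
          rw [← ENNReal.rpow_mul, mul_one_div_cancel hm0.ne', ENNReal.rpow_one]
      _ ≤ _ := by
          gcongr
          exact Finset.single_le_sum (f := fun k => u k x ^ m) (fun _ _ => zero_le) hk
  rcases eq_or_ne Z ∞ with hZ | hZ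
  · rw [hZ, ENNReal.top_rpow_of_pos hm0]; exact le_top
  have hY : Y ≠ ∞ := by
    refine (ENNReal.sum_lt_top.2 (fun k hk' => ?_)).ne
    exact ENNReal.rpow_lt_top_of_nonneg hm0.le (ne_top_of_le_ne_top hZ (hk k hk'))
  rcases eq_or_ne Y 0 with hY0 | hY0
  · rw [hY0]; exact zero_le
  have hconj := Real.HolderConjugate.conjExponent hm1
  set m' := Real.conjExponent m
  have hm' : (m - 1) * m' = m := by
    simp only [m', Real.conjExponent]
    have : m - 1 ≠ 0 := by linarith
    field_simp
  have h1 : Y ≤ Y ^ (1 / m') * Z := by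
    calc Y = ∑ k ∈ S, ∫⁻ x, (∫⁻ x, u k x ∂μ) ^ (m - 1) * u k x ∂μ := by
          refine Finset.sum_congr rfl (fun k _ => ?_)
          rw [lintegral_const_mul _ (hu k)]
          nth_rewrite 3 [← ENNReal.rpow_one (∫⁻ x, u k x ∂μ)]
          rw [← ENNReal.rpow_add_of_nonneg _ _ (by linarith) zero_le_one]; ring_nf
      _ = ∫⁻ x, ∑ k ∈ S, (∫⁻ x, u k x ∂μ) ^ (m - 1) * u k x ∂μ := by
          rw [lintegral_finsetSum _ (fun k _ => (hu k).const_mul _)]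
      _ ≤ ∫⁻ x, Y ^ (1 / m') * (∑ k ∈ S, u k x ^ m) ^ (1 / m) ∂μ := by
          refine lintegral_mono (fun x => ?_)
          refine (ENNReal.inner_le_Lp_mul_Lq S _ _ hconj.symm).trans (le_of_eq ?_)
          simp_rw [← ENNReal.rpow_mul, hm']
          rfl
      _ = _ := by
          have hmeas : Measurable (fun x => ∑ k ∈ S, u k x ^ m) :=
            Finset.measurable_fun_sum S (fun k _ => (hu k).pow_const m)
          rw [lintegral_const_mul _ (hmeas.pow_const _)]
  have h2 : Y ^ (1 / m) ≤ Z := by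
    have hx : Y = Y ^ (1 / m') * Y ^ (1 / m) := by
      rw [← ENNReal.rpow_add _ _ hY0 hY]
      have := hconj.inv_add_inv_eq_one
      rw [one_div, one_div, add_comm, this, ENNReal.rpow_one]
    have hne0 : Y ^ (1 / m') ≠ 0 := by
      simp only [ne_eq, ENNReal.rpow_eq_zero_iff]
      tauto
    have hnet : Y ^ (1 / m') ≠ ∞ := by
      simp only [ne_eq, ENNReal.rpow_eq_top_iff]
      tauto
    refine (ENNReal.mul_le_mul_iff_right hne0 hnet).1 ?_
    rw [← hx]; exact h1
  calc Y = (Y ^ (1 / m)) ^ m := by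
        rw [← ENNReal.rpow_mul, one_div_mul_cancel hm0.ne', ENNReal.rpow_one]
    _ ≤ _ := by gcongr

lemma tsum_mink {X : Type*} [MeasurableSpace X] {μ : Measure X} {c : ℤ → X → ℝ≥0∞}
    (hc : ∀ k, Measurable (c k)) {p β : ℝ} (hp0 : 0 < p) (hp : p ≤ 2) (hβ0 : 0 < β) (hβ : β ≤ 2) :
    ∑' k, ((∫⁻ x, c k x ^ p ∂μ) ^ (1 / p)) ^ 2 ≤
      ((∫⁻ x, ((∑' k, c k x ^ β) ^ (1 / β)) ^ p ∂μ) ^ (1 / p)) ^ 2 := by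
  have e1 : ∀ x : ℝ≥0∞, (x ^ (1 / p)) ^ 2 = x ^ (2 / p) := by
    intro x
    rw [← ENNReal.rpow_natCast, ← ENNReal.rpow_mul]; congr 1; push_cast; ring
  simp_rw [e1]
  have hm : 1 ≤ 2 / p := by rw [le_div_iff₀ hp0]; linarith
  rw [ENNReal.tsum_eq_iSup_sum]
  refine iSup_le (fun S => ?_)
  refine (minkowski_finset S (fun k => (hc k).pow_const p) hm).trans ?_
  refine ENNReal.rpow_le_rpow (lintegral_mono (fun x => ?_)) (by positivity)
  simp only
  simp_rw [← ENNReal.rpow_mul]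
  have h3 : ∑ k ∈ S, c k x ^ (p * (2 / p)) ≤ (∑' k, c k x ^ β) ^ (2 / β) := by
    refine (ENNReal.sum_le_tsum S).trans ?_
    refine le_trans (le_of_eq ?_) (tsum_rpow_le (fun k => c k x ^ β) (by rw [le_div_iff₀ hβ0]; linarith : 1 ≤ 2 / β))
    congr 1; ext k
    rw [← ENNReal.rpow_mul]; congr 1; field_simp
  refine (ENNReal.rpow_le_rpow h3 (by positivity)).trans (le_of_eq ?_)
  rw [← ENNReal.rpow_mul]; congr 1; field_simp

section Sum
variable {H : Type*} [NormedAddCommGroup H] [InnerProductSpace ℂ H] [CompleteSpace H]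

/-- constant -/
def cCross (σ q : ℝ) : ℝ≥0∞ :=
  ENNReal.ofReal (cSelf σ q) ^ (1 / (2 : ℝ)) * ENNReal.ofReal (2 ^ (1 / q)) + ENNReal.ofReal (cTail σ q)

lemma cCross_ne_top (σ q : ℝ) : cCross σ q ≠ ∞ := by
  unfold cCross
  refine ENNReal.add_ne_top.2 ⟨ENNReal.mul_ne_top ?_ ENNReal.ofReal_ne_top, ENNReal.ofReal_ne_top⟩
  exact ENNReal.rpow_ne_top_of_nonneg (by norm_num) ENNReal.ofReal_ne_top

lemma cross_decay {σ q p γ x y δ : ℝ} (hq : 2 ≤ q) (hpq : p.HolderConjugate q)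
    (hγ : γ = σ / 2 - 1 / q) (hγ0 : 0 < γ) (hxy : x ≤ y) (hδ1 : δ ≤ 1 / (4 * q)) (hδ2 : δ ≤ γ / 2)
    {f g : ℝ → H} (hf : Integrable f) (hg : Integrable g)
    {a b : ℝ → ℝ≥0∞} (ha : Measurable a) (hb : Measurable b)
    (h1 : ∀ s, ‖f s‖ₑ ≤ ENNReal.ofReal (((2 : ℝ) ^ x) ^ (-(1 / q))) * a s)
    (h1' : ∀ s, ‖g s‖ₑ ≤ ENNReal.ofReal (((2 : ℝ) ^ y) ^ (-(1 / q))) * b s)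
    (h2 : ∀ s t, s ≠ t → ‖inner ℂ (f s) (f t)‖ₑ ≤ ENNReal.ofReal (|t - s| ^ (-σ)) *
      (ENNReal.ofReal (((2 : ℝ) ^ x) ^ γ) * a s * (ENNReal.ofReal (((2 : ℝ) ^ x) ^ γ) * a t)))
    (h2' : ∀ s t, s ≠ t → ‖inner ℂ (f s) (g t)‖ₑ ≤ ENNReal.ofReal (|t - s| ^ (-σ)) *
      (ENNReal.ofReal (((2 : ℝ) ^ x) ^ γ) * a s * (ENNReal.ofReal (((2 : ℝ) ^ y) ^ γ) * b t))) :
    ‖inner ℂ (∫ s, f s) (∫ t, g t)‖ₑ ≤ cCross σ q * ENNReal.ofReal (2 ^ (-(δ * (y - x)))) *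
      ((∫⁻ s, a s ^ p) ^ (1 / p) * (∫⁻ t, b t ^ p) ^ (1 / p)) := by
  have hq0 : 0 < q := by linarith
  have h20 : (0 : ℝ) < 2 := by norm_num
  refine (cross_bound (ρ := 2 ^ ((x + 3 * y) / 4)) hq hpq hγ hγ0 (by positivity) (by positivity)
    (by positivity) hf hg ha hb h1 h1' h2 h2').trans ?_
  gcongr
  rw [cCross, add_mul]
  refine add_le_add ?_ ?_
  · rw [mul_assoc, mul_assoc]
    refine mul_le_mul' le_rfl ?_
    rw [ENNReal.ofReal_rpow_of_nonneg (by positivity) (by positivity),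
      ← ENNReal.ofReal_mul (by positivity), ← ENNReal.ofReal_mul (by positivity)]
    refine ENNReal.ofReal_le_ofReal ?_
    rw [Real.mul_rpow (by positivity) (by positivity), mul_left_comm]
    gcongr
    rw [← Real.rpow_mul h20.le, ← Real.rpow_mul h20.le, ← Real.rpow_add h20]
    refine Real.rpow_le_rpow_of_exponent_le (by norm_num) ?_
    have : y * -(1 / q) + (x + 3 * y) / 4 * (1 / q) = -(1 / (4 * q) * (y - x)) := by ring
    rw [this]
    exact neg_le_neg (mul_le_mul_of_nonneg_right hδ1 (by linarith))
  · rw [mul_comm (cTail σ q), ENNReal.ofReal_mul (p := ((2 : ℝ) ^ ((x + 3 * y) / 4)) ^ (-(2 * γ))) (by positivity),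
      ← mul_assoc, mul_comm]
    refine mul_le_mul' le_rfl ?_
    rw [← ENNReal.ofReal_mul (by positivity), ← ENNReal.ofReal_mul (by positivity)]
    refine ENNReal.ofReal_le_ofReal ?_
    rw [← Real.rpow_mul h20.le, ← Real.rpow_mul h20.le, ← Real.rpow_mul h20.le, ← Real.rpow_add h20,
      ← Real.rpow_add h20]
    refine Real.rpow_le_rpow_of_exponent_le (by norm_num) ?_
    have : x * γ + y * γ + (x + 3 * y) / 4 * -(2 * γ) = -(γ / 2 * (y - x)) := by ring
    rw [this]
    exact neg_le_neg (mul_le_mul_of_nonneg_right hδ2 (by linarith))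

theorem atoms_sum {σ q p γ β : ℝ} (hσ : 0 < σ) (hq : 2 ≤ q) (hpq : p.HolderConjugate q)
    (hγ : γ = σ / 2 - 1 / q) (hγ0 : 0 < γ) (hβ0 : 0 < β) (hβ : β ≤ 2) :
    ∃ C : ℝ≥0∞, C ≠ ∞ ∧ ∀ (f : ℤ → ℝ → H) (c : ℤ → ℝ → ℝ≥0∞), (∀ k, Integrable (f k)) →
      (∀ k, Measurable (c k)) →
      (∀ k s, ‖f k s‖ₑ ≤ ENNReal.ofReal (((2 : ℝ) ^ ((k : ℝ) / σ)) ^ (-(1 / q))) * c k s) →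
      (∀ k l s t, s ≠ t → ‖inner ℂ (f k s) (f l t)‖ₑ ≤ ENNReal.ofReal (|t - s| ^ (-σ)) *
        (ENNReal.ofReal (((2 : ℝ) ^ ((k : ℝ) / σ)) ^ γ) * c k s *
          (ENNReal.ofReal (((2 : ℝ) ^ ((l : ℝ) / σ)) ^ γ) * c l t))) →
      ∀ S : Finset ℤ, ‖∑ k ∈ S, ∫ s, f k s‖ₑ ^ 2 ≤
        C * ((∫⁻ s, ((∑' k, c k s ^ β) ^ (1 / β)) ^ p) ^ (1 / p)) ^ 2 := by
  have hq0 : 0 < q := by linarith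
  set δ := min (1 / (4 * q)) (γ / 2)
  have hδ0 : 0 < δ := lt_min (by positivity) (by positivity)
  set θ : ℝ≥0∞ := ENNReal.ofReal (2 ^ (-(δ / σ)))
  have hθ : θ < 1 := by
    rw [← ENNReal.ofReal_one]
    refine (ENNReal.ofReal_lt_ofReal_iff one_pos).2 ?_
    exact Real.rpow_lt_one_of_one_lt_of_neg (by norm_num) (by simp only [Left.neg_neg_iff]; positivity)
  have hp2 : p ≤ 2 := by
    have := hpq.inv_add_inv_eq_one
    have h3 : q⁻¹ ≤ 2⁻¹ := inv_anti₀ (by norm_num) hq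
    have h4 : 2⁻¹ ≤ p⁻¹ := by linarith
    exact (inv_le_inv₀ (by norm_num) hpq.pos).1 h4
  refine ⟨cCross σ q * (2 * ∑' m : ℤ, θ ^ m.natAbs), ENNReal.mul_ne_top (cCross_ne_top _ _)
    (ENNReal.mul_ne_top (by simp) (tsum_geom_int hθ)), ?_⟩
  intro f c hf hc h1 h2 S
  set A : ℤ → ℝ≥0∞ := fun k => (∫⁻ s, c k s ^ p) ^ (1 / p) with hA
  have key0 : ∀ k l : ℤ, k ≤ l → ‖inner ℂ (∫ s, f k s) (∫ s, f l s)‖ₑ ≤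
      cCross σ q * (θ ^ (k - l).natAbs * (A k * A l)) := by
    intro k l hkl
    refine (cross_decay (δ := δ) hq hpq hγ hγ0 (x := (k : ℝ) / σ) (y := (l : ℝ) / σ) ?_ (min_le_left _ _)
      (min_le_right _ _) (hf k) (hf l) (hc k) (hc l) (h1 k) (h1 l) (h2 k k) (h2 k l)).trans (le_of_eq ?_)
    · gcongr
    · rw [mul_assoc]
      congr 3
      simp only [θ]
      rw [← ENNReal.ofReal_pow (by positivity), ← Real.rpow_natCast, ← Real.rpow_mul (by norm_num)]
      have : (((k - l).natAbs : ℕ) : ℝ) = (l : ℝ) - k := by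
        rw [Nat.cast_natAbs, abs_of_nonpos (by omega)]; push_cast; ring
      rw [this]; congr 2; field_simp
  have key : ∀ k l : ℤ, ‖inner ℂ (∫ s, f k s) (∫ s, f l s)‖ₑ ≤
      cCross σ q * (θ ^ (k - l).natAbs * (A k * A l)) := by
    intro k l
    rcases le_total k l with h | h
    · exact key0 k l h
    · rw [enorm_inner_symm]
      refine (key0 l k h).trans (le_of_eq ?_)
      rw [mul_comm (A l), show (l - k).natAbs = (k - l).natAbs by omega]
  calc _ = ‖inner ℂ (∑ k ∈ S, ∫ s, f k s) (∑ l ∈ S, ∫ s, f l s)‖ₑ := enorm_sq_eq _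
    _ ≤ ∑ k ∈ S, ∑ l ∈ S, ‖inner ℂ (∫ s, f k s) (∫ s, f l s)‖ₑ := by
        rw [sum_inner]
        refine (enorm_sum_le _ _).trans (Finset.sum_le_sum (fun k _ => ?_))
        rw [inner_sum]
        exact enorm_sum_le _ _
    _ ≤ ∑' k, ∑' l, cCross σ q * (θ ^ (k - l).natAbs * (A k * A l)) := by
        refine le_trans (Finset.sum_le_sum (fun k _ => ?_)) (ENNReal.sum_le_tsum S)
        exact (Finset.sum_le_sum (fun l _ => key k l)).trans (ENNReal.sum_le_tsum S)
    _ = cCross σ q * ∑' k, ∑' l, (θ ^ (k - l).natAbs * (A k * A l)) := by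
        simp_rw [ENNReal.tsum_mul_left]
    _ ≤ cCross σ q * (2 * (∑' m : ℤ, θ ^ m.natAbs) * ∑' k, A k ^ 2) := by
        gcongr; exact schur_tsum θ A
    _ ≤ _ := by
        rw [← mul_assoc]
        gcongr
        exact tsum_mink hc hpq.pos hp2 hβ0 hβ

end Sum

/-- dyadic weight -/
def dw (k : ℤ) : ℝ≥0∞ := (2 : ℝ≥0∞) ^ (k : ℝ)

lemma dw_pos (k : ℤ) : 0 < dw k := ENNReal.rpow_pos (by norm_num) (by norm_num)
lemma dw_ne_top (k : ℤ) : dw k ≠ ∞ := ENNReal.rpow_ne_top_of_ne_zero (by norm_num) (by norm_num)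
lemma dw_zpow (k : ℤ) : dw k = 2 ^ k := ENNReal.rpow_intCast _ _
lemma dw_mono {k l : ℤ} (h : k ≤ l) : dw k ≤ dw l :=
  ENNReal.rpow_le_rpow_of_exponent_le (by norm_num) (by exact_mod_cast h)
lemma dw_add (k l : ℤ) : dw (k + l) = dw k * dw l := by
  simp only [dw]; push_cast; exact ENNReal.rpow_add _ _ (by norm_num) (by norm_num)
lemma dw_one : dw 1 = 2 := by simp [dw]

lemma dw_sum_lt (m : ℝ≥0∞) : ∑' k : ℤ, (if dw k < m then dw k else 0) ≤ 2 * m := by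
  rcases eq_or_ne m ∞ with rfl | hm
  · simp
  rcases eq_or_ne m 0 with rfl | hm0
  · simp
  obtain ⟨n, hn1, hn2⟩ := ENNReal.exists_mem_Ioc_zpow hm0 hm (y := 2) (by norm_num) (by simp)
  rw [← dw_zpow] at hn1 hn2
  have h1 : ∀ k : ℤ, (if dw k < m then dw k else 0) ≤ ∑' j : ℕ, if (n - j : ℤ) = k then dw (n - j) else 0 := by
    intro k
    split_ifs with hk
    · have hkn : k ≤ n := by
        by_contra h
        have := dw_mono (show n + 1 ≤ k by omega)
        exact absurd (hk.trans_le hn2) (not_lt.2 this)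
      refine le_trans ?_ (ENNReal.le_tsum (n - k).toNat)
      rw [if_pos (by omega)]
      refine dw_mono (by omega)
    · exact zero_le
  refine (ENNReal.tsum_le_tsum h1).trans ?_
  rw [ENNReal.tsum_comm]
  have h2 : ∀ j : ℕ, (∑' k : ℤ, if (n - j : ℤ) = k then dw (n - j) else 0) = dw n * (2⁻¹) ^ j := by
    intro j
    rw [tsum_ite_eq', sub_eq_add_neg, dw_add, dw_zpow (-j), ENNReal.zpow_neg, zpow_natCast, ENNReal.inv_pow]
  simp_rw [h2]
  rw [ENNReal.tsum_mul_left, ENNReal.tsum_geometric]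
  simp only [ENNReal.one_sub_inv_two, inv_inv]
  rw [mul_comm]
  gcongr

section Lam
variable {X : Type*} [MeasurableSpace X]

/-- dyadic rearrangement levels -/
def lam (μ : Measure X) (g : X → ℝ≥0∞) (k : ℤ) : ℝ≥0∞ := sInf {l | μ {x | l < g x} ≤ dw k}

lemma lam_meas_le (μ : Measure X) (g : X → ℝ≥0∞) (k : ℤ) : μ {x | lam μ g k < g x} ≤ dw k := by
  have hne : {l | μ {x | l < g x} ≤ dw k}.Nonempty := ⟨∞, by simp⟩
  obtain ⟨u, hu, hul, hum⟩ := exists_seq_tendsto_sInf hne (OrderBot.bddBelow _)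
  have h1 : {x | lam μ g k < g x} = ⋃ n, {x | u n < g x} := by
    ext x
    simp only [Set.mem_ofPred_eq, Set.mem_iUnion]
    constructor
    · intro hx
      exact ((tendsto_order.1 hul).2 _ hx).exists
    · rintro ⟨n, hn⟩
      exact lt_of_le_of_lt (sInf_le (hum n)) hn
  rw [h1, Monotone.measure_iUnion]
  · exact iSup_le (fun n => hum n)
  · intro m n hmn x hx
    exact lt_of_le_of_lt (hu hmn) hx

lemma lt_lam_iff (μ : Measure X) (g : X → ℝ≥0∞) (k : ℤ) (l : ℝ≥0∞) :
    l < lam μ g k ↔ dw k < μ {x | l < g x} := by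
  constructor
  · intro h
    by_contra h'
    have h3 : lam μ g k ≤ l := sInf_le (Set.mem_ofPred_eq ▸ not_lt.1 h')
    exact absurd h3 (not_le.2 h)
  · intro h
    by_contra h'
    refine absurd ((measure_mono (fun x hx => ?_)).trans (lam_meas_le μ g k)) (not_le.2 h)
    exact lt_of_le_of_lt (not_lt.1 h') hx

lemma lam_antitone (μ : Measure X) (g : X → ℝ≥0∞) {k l : ℤ} (h : k ≤ l) : lam μ g l ≤ lam μ g k :=
  sInf_le ((lam_meas_le μ g k).trans (dw_mono h))

lemma lam_measurable {Y : Type*} [MeasurableSpace Y] (μ : Measure X) [SFinite μ] {G : Y × X → ℝ≥0∞}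
    (hG : Measurable G) (k : ℤ) : Measurable (fun s => lam μ (fun x => G (s, x)) k) := by
  refine measurable_of_Ioi (fun l => ?_)
  have : (fun s => lam μ (fun x => G (s, x)) k) ⁻¹' Set.Ioi l =
      {s | dw k < μ (Prod.mk s ⁻¹' {p | l < G p})} := by
    ext s; simp only [Set.mem_preimage, Set.mem_Ioi, lt_lam_iff]; rfl
  rw [this]
  exact measurableSet_lt measurable_const
    (measurable_measure_prodMk_left (measurableSet_lt measurable_const hG))

lemma lintegral_level (c : ℝ≥0∞) :
    ∫⁻ τ in Set.Ioi (0 : ℝ), (if ENNReal.ofReal τ < c then 1 else 0) = c := by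
  have h1 : ∀ τ : ℝ, (if ENNReal.ofReal τ < c then (1 : ℝ≥0∞) else 0) =
      {τ : ℝ | ENNReal.ofReal τ < c}.indicator (fun _ => 1) τ := by
    intro τ; simp [Set.indicator_apply]
  simp_rw [h1]
  have hm : MeasurableSet {τ : ℝ | ENNReal.ofReal τ < c} :=
    measurableSet_lt ENNReal.measurable_ofReal measurable_const
  rw [lintegral_indicator hm, setLIntegral_one, Measure.restrict_apply hm]
  rcases eq_or_ne c ∞ with rfl | hc
  · simp
  · have : {τ : ℝ | ENNReal.ofReal τ < c} ∩ Set.Ioi 0 = Set.Ioo 0 c.toReal := by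
      ext τ
      simp only [Set.mem_inter_iff, Set.mem_ofPred_eq, Set.mem_Ioi, Set.mem_Ioo]
      constructor
      · rintro ⟨h, h0⟩
        exact ⟨h0, (ENNReal.ofReal_lt_iff_lt_toReal h0.le hc).1 h⟩
      · rintro ⟨h0, h⟩
        exact ⟨(ENNReal.ofReal_lt_iff_lt_toReal h0.le hc).2 h, h0⟩
    rw [this, Real.volume_Ioo, sub_zero, ENNReal.ofReal_toReal hc]

lemma lintegral_layer (μ : Measure X) [SFinite μ] {h : X → ℝ≥0∞} (hh : Measurable h) :
    ∫⁻ x, h x ∂μ = ∫⁻ τ in Set.Ioi (0 : ℝ), μ {x | ENNReal.ofReal τ < h x} := by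
  have hm : MeasurableSet {p : X × ℝ | ENNReal.ofReal p.2 < h p.1} :=
    measurableSet_lt (by fun_prop) (by fun_prop)
  calc _ = ∫⁻ x, (∫⁻ τ in Set.Ioi (0 : ℝ), (if ENNReal.ofReal τ < h x then 1 else 0)) ∂μ := by
        simp_rw [lintegral_level]
    _ = ∫⁻ τ in Set.Ioi (0 : ℝ), (∫⁻ x, (if ENNReal.ofReal τ < h x then 1 else 0) ∂μ) := by
        refine lintegral_lintegral_swap (Measurable.aemeasurable ?_)
        exact Measurable.ite hm measurable_const measurable_const
    _ = _ := by
        refine lintegral_congr (fun τ => ?_)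
        have h1 : ∀ x : X, (if ENNReal.ofReal τ < h x then (1 : ℝ≥0∞) else 0) =
            {x : X | ENNReal.ofReal τ < h x}.indicator (fun _ => 1) x := by
          intro x; simp [Set.indicator_apply]
        simp_rw [h1]
        rw [lintegral_indicator (measurableSet_lt measurable_const hh), setLIntegral_one]

lemma lam_sum (μ : Measure X) [SFinite μ] {g : X → ℝ≥0∞} (hg : Measurable g) {β : ℝ} (hβ : 0 < β) :
    ∑' k : ℤ, dw k * lam μ g k ^ β ≤ 2 * ∫⁻ x, g x ^ β ∂μ := by
  have hlt : ∀ a b : ℝ≥0∞, a < b ^ β ↔ a ^ (1 / β) < b := by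
    intro a b
    rw [← ENNReal.rpow_lt_rpow_iff (x := a ^ (1 / β)) hβ, ← ENNReal.rpow_mul, one_div_mul_cancel hβ.ne',
      ENNReal.rpow_one]
  calc _ = ∑' k : ℤ, ∫⁻ τ in Set.Ioi (0 : ℝ), dw k * (if ENNReal.ofReal τ < lam μ g k ^ β then 1 else 0) := by
        congr 1; ext k
        rw [lintegral_const_mul', lintegral_level]
        exact dw_ne_top k
    _ = ∫⁻ τ in Set.Ioi (0 : ℝ), ∑' k : ℤ, dw k * (if ENNReal.ofReal τ < lam μ g k ^ β then 1 else 0) := by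
        rw [lintegral_tsum]
        intro k
        refine Measurable.aemeasurable (Measurable.const_mul ?_ _)
        exact Measurable.ite (measurableSet_lt (by fun_prop) (by fun_prop)) measurable_const measurable_const
    _ ≤ ∫⁻ τ in Set.Ioi (0 : ℝ), 2 * μ {x | ENNReal.ofReal τ < g x ^ β} := by
        refine lintegral_mono (fun τ => ?_)
        refine le_trans (le_of_eq ?_) (dw_sum_lt _)
        congr 1; ext k
        simp_rw [hlt, lt_lam_iff]
        split_ifs <;> simp
    _ = _ := by
        rw [lintegral_const_mul' _ _ (by simp), ← lintegral_layer μ (hg.pow_const β)]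

end Lam

lemma dw_tendsto_top : Filter.Tendsto (fun K : ℕ => dw (K : ℤ)) Filter.atTop (nhds ∞) := by
  have : (fun K : ℕ => dw (K : ℤ)) = fun K : ℕ => (2 : ℝ≥0∞) ^ K := by
    ext K; rw [dw_zpow, zpow_natCast]
  rw [this]
  exact ENNReal.tendsto_pow_atTop_nhds_top_iff.2 (by norm_num)

lemma dw_neg_tendsto : Filter.Tendsto (fun K : ℕ => dw (-(K : ℤ))) Filter.atTop (nhds 0) := by
  have : (fun K : ℕ => dw (-(K : ℤ))) = fun K : ℕ => (2⁻¹ : ℝ≥0∞) ^ K := by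
    ext K; rw [dw_zpow, ENNReal.zpow_neg, zpow_natCast, ENNReal.inv_pow]
  rw [this]
  exact ENNReal.tendsto_pow_atTop_nhds_zero_of_lt_one (by simp)

section Lam2
variable {X : Type*} [MeasurableSpace X]

lemma lam_eventually_lt (μ : Measure X) {g : X → ℝ≥0∞} (hg : Measurable g) {β : ℝ} (hβ : 0 < β)
    (hfin : ∫⁻ x, g x ^ β ∂μ ≠ ∞) {v : ℝ≥0∞} (hv : 0 < v) :
    ∀ᶠ K : ℕ in Filter.atTop, lam μ g K < v := by
  obtain ⟨l, hl0, hlv⟩ := exists_between hv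
  have h1 : μ {x | l < g x} < ∞ := by
    refine lt_of_le_of_lt (measure_mono (fun x hx => ?_)) (meas_ge_le_lintegral_div (μ := μ)
      (hg.pow_const β).aemeasurable (ε := l ^ β) ?_ ?_ |>.trans_lt (ENNReal.div_lt_top hfin ?_))
    · have hx' : l < g x := hx
      exact ENNReal.rpow_le_rpow hx'.le hβ.le
    · exact (ENNReal.rpow_pos hl0 (hlv.ne_top)).ne'
    · exact ENNReal.rpow_ne_top_of_nonneg hβ.le hlv.ne_top
    · exact (ENNReal.rpow_pos hl0 (hlv.ne_top)).ne'
  filter_upwards [(tendsto_order.1 dw_tendsto_top).1 _ h1] with K hK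
  refine lt_of_le_of_lt (not_lt.1 (fun h => ?_)) hlv
  rw [lt_lam_iff] at h
  exact absurd h (not_lt.2 hK.le)

lemma lam_ae_le (μ : Measure X) (g : X → ℝ≥0∞) :
    ∀ᵐ x ∂μ, ∀ᶠ K : ℕ in Filter.atTop, g x ≤ lam μ g (-(K : ℤ)) := by
  have h1 : μ {x | ∀ K : ℕ, lam μ g (-(K : ℤ)) < g x} = 0 := by
    refine le_antisymm ?_ zero_le
    refine ge_of_tendsto' dw_neg_tendsto (fun K => ?_)
    refine (measure_mono (fun x hx => ?_)).trans (lam_meas_le μ g (-(K : ℤ)))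
    exact hx K
  rw [ae_iff]
  refine measure_mono_null (fun x hx => ?_) h1
  intro K
  by_contra hK
  apply hx
  filter_upwards [Filter.eventually_ge_atTop K] with K' hK'
  exact (not_lt.1 hK).trans (lam_antitone μ g (by omega))

end Lam2

section Atoms
set_option linter.unusedSectionVars false
variable {V : Type*} [NormedAddCommGroup V] [InnerProductSpace ℝ V] [FiniteDimensional ℝ V]
  [MeasurableSpace V] [BorelSpace V]

/-- levels -/
def lv (F : ℝ × V → ℂ) (k : ℤ) (s : ℝ) : ℝ≥0∞ := lam volume (fun x => ‖F (s, x)‖ₑ) k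

/-- truncation above a level -/
def cut (F : ℝ × V → ℂ) (k : ℤ) (z : ℝ × V) : ℂ := if lv F k z.1 < ‖F z‖ₑ then F z else 0

/-- atoms -/
def atomF (F : ℝ × V → ℂ) (k : ℤ) (z : ℝ × V) : ℂ := cut F (k + 1) z - cut F k z

/-- remainder -/
def remF (F : ℝ × V → ℂ) (K : ℕ) (z : ℝ × V) : ℂ := F z - cut F K z + cut F (-(K : ℤ)) z

lemma lv_measurable {F : ℝ × V → ℂ} (hF : Measurable F) (k : ℤ) : Measurable (lv F k) :=
  lam_measurable volume (G := fun z : ℝ × V => ‖F z‖ₑ) hF.enorm k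

lemma lv_antitone (F : ℝ × V → ℂ) {k l : ℤ} (h : k ≤ l) (s : ℝ) : lv F l s ≤ lv F k s :=
  lam_antitone _ _ h

lemma cut_measurable {F : ℝ × V → ℂ} (hF : Measurable F) (k : ℤ) : Measurable (cut F k) := by
  unfold cut
  exact Measurable.ite (measurableSet_lt ((lv_measurable hF k).comp measurable_fst) hF.enorm) hF measurable_const

lemma atomF_enorm (F : ℝ × V → ℂ) (k : ℤ) (s : ℝ) (x : V) :
    ‖atomF F k (s, x)‖ₑ ≤ {x | lv F (k + 1) s < ‖F (s, x)‖ₑ}.indicator (fun _ => lv F k s) x := by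
  have hle := lv_antitone F (show k ≤ k + 1 by omega) s
  by_cases h1 : lv F (k + 1) s < ‖F (s, x)‖ₑ
  · rw [Set.indicator_of_mem (show x ∈ {x | lv F (k + 1) s < ‖F (s, x)‖ₑ} from h1)]
    by_cases h2 : lv F k s < ‖F (s, x)‖ₑ
    · simp [atomF, cut, h1, h2]
    · simp only [atomF, cut, h1, h2, if_true, if_false, sub_zero]
      exact not_lt.1 h2
  · have h2 : ¬ lv F k s < ‖F (s, x)‖ₑ := fun h => h1 (lt_of_le_of_lt hle h)
    simp [atomF, cut, h1, h2]

lemma atomF_norm_le (F : ℝ × V → ℂ) (k : ℤ) (z : ℝ × V) : ‖atomF F k z‖ ≤ ‖F z‖ := by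
  have hle := lv_antitone F (show k ≤ k + 1 by omega) z.1
  by_cases h1 : lv F (k + 1) z.1 < ‖F z‖ₑ
  · by_cases h2 : lv F k z.1 < ‖F z‖ₑ <;> simp [atomF, cut, h1, h2]
  · have h2 : ¬ lv F k z.1 < ‖F z‖ₑ := fun h => h1 (lt_of_le_of_lt hle h)
    simp [atomF, cut, h1, h2]

lemma remF_norm_le (F : ℝ × V → ℂ) (K : ℕ) (z : ℝ × V) : ‖remF F K z‖ ≤ ‖F z‖ := by
  have hle := lv_antitone F (show (-(K : ℤ)) ≤ K by omega) z.1
  by_cases h1 : lv F K z.1 < ‖F z‖ₑ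
  · by_cases h2 : lv F (-(K : ℤ)) z.1 < ‖F z‖ₑ <;> simp [remF, cut, h1, h2]
  · have h2 : ¬ lv F (-(K : ℤ)) z.1 < ‖F z‖ₑ := fun h => h1 (lt_of_le_of_lt hle h)
    simp [remF, cut, h1, h2]

lemma atomF_dom {F : ℝ × V → ℂ} (hF : Dom F) (k : ℤ) : Dom (atomF F k) :=
  hF.mono ((cut_measurable hF.1 _).sub (cut_measurable hF.1 _)) (atomF_norm_le F k)

lemma remF_dom {F : ℝ × V → ℂ} (hF : Dom F) (K : ℕ) : Dom (remF F K) :=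
  hF.mono ((hF.1.sub (cut_measurable hF.1 _)).add (cut_measurable hF.1 _)) (remF_norm_le F K)

/-- the symmetric window of indices -/
def win (K : ℕ) : Finset ℤ :=
  (Finset.range (2 * K)).map ⟨fun j : ℕ => (j : ℤ) - K, fun a b h => by simpa using h⟩

lemma decomp (F : ℝ × V → ℂ) (K : ℕ) (z : ℝ × V) : F z = (∑ k ∈ win K, atomF F k z) + remF F K z := by
  have h1 : ∑ k ∈ win K, atomF F k z = cut F K z - cut F (-(K : ℤ)) z := by
    rw [win, Finset.sum_map]
    simp only [Function.Embedding.coeFn_mk, atomF]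
    have := Finset.sum_range_sub (fun j : ℕ => cut F ((j : ℤ) - K) z) (2 * K)
    simp only [Nat.cast_add, Nat.cast_one, Nat.cast_mul, Nat.cast_ofNat, Nat.cast_zero, zero_sub] at this
    rw [show (2 * (K : ℤ) - K) = K by ring] at this
    rw [← this]
    refine Finset.sum_congr rfl (fun j _ => ?_)
    have e : (j : ℤ) - K + 1 = j + 1 - K := by ring
    show cut F ((j : ℤ) - K + 1) z - cut F ((j : ℤ) - K) z = _
    rw [e]
  rw [h1, remF]; ring

lemma atomF_L1 {F : ℝ × V → ℂ} (hF : Dom F) (k : ℤ) (s : ℝ) :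
    ∫⁻ x, ‖atomF F k (s, x)‖ₑ ≤ lv F k s * dw (k + 1) := by
  refine (lintegral_mono (atomF_enorm F k s)).trans ?_
  rw [lintegral_indicator (measurableSet_lt measurable_const (hF.slice_measurable s).enorm),
    setLIntegral_const]
  gcongr
  exact lam_meas_le _ _ _

lemma atomF_L2 {F : ℝ × V → ℂ} (hF : Dom F) (k : ℤ) (s : ℝ) :
    eLpNorm (fun x => atomF F k (s, x)) 2 volume ≤ lv F k s * dw (k + 1) ^ (1 / (2 : ℝ)) := by
  rw [eLpNorm_eq_lintegral_rpow_enorm_toReal (by simp) (by simp)]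
  simp only [ENNReal.toReal_ofNat]
  have h1 : ∫⁻ x, ‖atomF F k (s, x)‖ₑ ^ (2 : ℝ) ≤ lv F k s ^ (2 : ℝ) * dw (k + 1) := by
    calc _ ≤ ∫⁻ x, {x | lv F (k + 1) s < ‖F (s, x)‖ₑ}.indicator (fun _ => lv F k s ^ (2 : ℝ)) x := by
          refine lintegral_mono (fun x => ?_)
          refine (ENNReal.rpow_le_rpow (atomF_enorm F k s x) (by norm_num)).trans (le_of_eq ?_)
          by_cases h : x ∈ {x | lv F (k + 1) s < ‖F (s, x)‖ₑ}
          · rw [Set.indicator_of_mem h, Set.indicator_of_mem h]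
          · rw [Set.indicator_of_notMem h, Set.indicator_of_notMem h]; simp
      _ ≤ _ := by
          rw [lintegral_indicator (measurableSet_lt measurable_const (hF.slice_measurable s).enorm),
            setLIntegral_const]
          gcongr
          exact lam_meas_le _ _ _
  refine (ENNReal.rpow_le_rpow h1 (by norm_num)).trans (le_of_eq ?_)
  rw [ENNReal.mul_rpow_of_nonneg _ _ (by norm_num), ← ENNReal.rpow_mul]
  norm_num

lemma Dom.ev_inner_enorm {G G' : ℝ × V → ℂ} (hG : Dom G) (hG' : Dom G') {s t : ℝ} (hst : s ≠ t) :
    ‖inner ℂ (ev G s) (ev G' t)‖ₑ ≤ ENNReal.ofReal (|t - s| ^ (-((Module.finrank ℝ V : ℝ) / 2))) *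
      ((∫⁻ x, ‖G (s, x)‖ₑ) * ∫⁻ x, ‖G' (t, x)‖ₑ) := by
  rw [← ofReal_integral_norm_eq_lintegral_enorm (hG.integrable s),
    ← ofReal_integral_norm_eq_lintegral_enorm (hG'.integrable t),
    ← ENNReal.ofReal_mul (integral_nonneg fun _ => norm_nonneg _), ← ENNReal.ofReal_mul (by positivity),
    ← ofReal_norm]
  exact ENNReal.ofReal_le_ofReal (hG.ev_inner hG' hst)

lemma eLp2_measurable {G : ℝ × V → ℂ} (hG : Measurable G) {p : ℝ≥0∞} (hp : p ≠ 0) (hp' : p ≠ ∞) :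
    Measurable (fun s => eLpNorm (fun x => G (s, x)) p volume) := by
  simp_rw [eLpNorm_eq_lintegral_rpow_enorm_toReal hp hp']
  refine Measurable.pow_const ?_ _
  exact Measurable.lintegral_prod_right' (f := fun z : ℝ × V => ‖G z‖ₑ ^ p.toReal) (hG.enorm.pow_const _)

lemma remF_tendsto {F : ℝ × V → ℂ} (hF : Dom F) :
    Filter.Tendsto (fun K : ℕ => ∫⁻ s, eLpNorm (fun x => remF F K (s, x)) 2 volume) Filter.atTop (nhds 0) := by
  obtain ⟨C, hC, hCb⟩ := hF.eLpNorm_le 2 (by norm_num)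
  have hIntble : ∫⁻ s : ℝ, ENNReal.ofReal (C * (1 + s ^ 2)⁻¹) ≠ ∞ :=
    (integrable_inv_one_add_sq.const_mul C).lintegral_lt_top.ne
  have h0 : (0 : ℝ≥0∞) = ∫⁻ _ : ℝ, 0 := by simp
  rw [h0]
  refine tendsto_lintegral_of_dominated_convergence (fun s : ℝ => ENNReal.ofReal (C * (1 + s ^ 2)⁻¹))
    (fun K => eLp2_measurable (remF_dom hF K).1 (by simp) (by simp)) ?_ hIntble ?_
  · intro K
    refine Filter.Eventually.of_forall (fun s => le_trans ?_ (hCb s))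
    exact eLpNorm_mono (fun x => remF_norm_le F K (s, x))
  · refine Filter.Eventually.of_forall (fun s => ?_)
    simp_rw [eLpNorm_eq_lintegral_rpow_enorm_toReal (show (2 : ℝ≥0∞) ≠ 0 by simp) (by simp : (2 : ℝ≥0∞) ≠ ∞)]
    simp only [ENNReal.toReal_ofNat]
    have hfin : ∫⁻ x, ‖F (s, x)‖ₑ ^ (2 : ℝ) ≠ ∞ := by
      have := (hF.memLp 2 (by norm_num) s).2
      rw [eLpNorm_lt_top_iff_lintegral_rpow_enorm_lt_top (by simp) (by simp)] at this
      simpa using this.ne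
    have h1 : Filter.Tendsto (fun K : ℕ => ∫⁻ x, ‖remF F K (s, x)‖ₑ ^ (2 : ℝ)) Filter.atTop (nhds 0) := by
      have h0 : (0 : ℝ≥0∞) = ∫⁻ _ : V, 0 := by simp
      rw [h0]
      refine tendsto_lintegral_of_dominated_convergence (fun x => ‖F (s, x)‖ₑ ^ (2 : ℝ))
        (fun K => ((remF_dom hF K).slice_measurable s).enorm.pow_const _) ?_ hfin ?_
      · intro K
        refine Filter.Eventually.of_forall (fun x => ?_)
        refine ENNReal.rpow_le_rpow ?_ (by norm_num)
        rw [enorm_le_iff_norm_le]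
        exact remF_norm_le F K (s, x)
      · filter_upwards [lam_ae_le volume (fun x => ‖F (s, x)‖ₑ)] with x hx
        refine tendsto_const_nhds.congr' ?_
        rcases eq_or_ne (F (s, x)) 0 with h0 | h0
        · refine Filter.Eventually.of_forall (fun K => ?_)
          simp [remF, cut, h0]
        · have hpos : 0 < ‖F (s, x)‖ₑ := by simpa using h0
          filter_upwards [hx, lam_eventually_lt volume (hF.slice_measurable s).enorm
            (by norm_num : (0 : ℝ) < 2) hfin hpos] with K hK1 hK2
          have a1 : lv F K s < ‖F (s, x)‖ₑ := hK2
          have a2 : ¬ lv F (-(K : ℤ)) s < ‖F (s, x)‖ₑ := not_lt.2 hK1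
          simp [remF, cut, a1, a2]
    have h2 := h1.ennrpow_const (1 / 2)
    simpa using h2

lemma limit_bound {F : ℝ × V → ℂ} (hF : Dom F) {B : ℝ≥0∞}
    (hB : ∀ S : Finset ℤ, ‖∑ k ∈ S, ∫ s, ev (atomF F k) s‖ₑ ≤ B) : ‖∫ s, ev F s‖ₑ ≤ B := by
  have h1 : ∀ K : ℕ, ‖∫ s, ev F s‖ₑ ≤ B + ∫⁻ s, eLpNorm (fun x => remF F K (s, x)) 2 volume := by
    intro K
    have hsum := dom_sum (win K) (fun k => atomF_dom hF k)
    have e1 : ∀ s, ev F s = (∑ k ∈ win K, ev (atomF F k) s) + ev (remF F K) s := by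
      intro s
      rw [← hsum.2 s, ← hsum.1.ev_add (remF_dom hF K)]
      congr 1; ext z; exact decomp F K z
    simp_rw [e1]
    rw [integral_add (integrable_finsetSum _ (fun k _ => (atomF_dom hF k).ev_integrable))
      (remF_dom hF K).ev_integrable, integral_finsetSum _ (fun k _ => (atomF_dom hF k).ev_integrable)]
    refine (enorm_add_le _ _).trans (add_le_add (hB _) ?_)
    refine (enorm_integral_le_lintegral_enorm _).trans (lintegral_mono (fun s => ?_))
    exact (remF_dom hF K).ev_enorm_le s
  have h2 := (remF_tendsto hF).const_add B
  rw [add_zero] at h2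
  exact ge_of_tendsto' h2 h1

end Atoms

lemma ofReal_two_rpow (x y : ℝ) : ENNReal.ofReal (((2:ℝ) ^ x) ^ y) = (2 : ℝ≥0∞) ^ (x * y) := by
  rw [← Real.rpow_mul (by norm_num), ← ENNReal.ofReal_rpow_of_pos (by norm_num)]
  simp

section Main
set_option linter.unusedSectionVars false
variable {V : Type*} [NormedAddCommGroup V] [InnerProductSpace ℝ V] [FiniteDimensional ℝ V]
  [MeasurableSpace V] [BorelSpace V]

lemma main_case {σ q p β : ℝ} (hV : (Module.finrank ℝ V : ℝ) / 2 = σ) (hσ : 0 < σ) (hq : 2 ≤ q)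
    (hpq : p.HolderConjugate q) (hβ0 : 0 < β) (hβ : 1 / β = 1 / 2 + 1 / (σ * q))
    (hγ0 : 0 < σ / 2 - 1 / q) :
    ∃ C : ℝ≥0∞, C ≠ ∞ ∧ ∀ F : ℝ × V → ℂ, Dom F →
      ‖∫ s, ev F s‖ₑ ≤ C * (∫⁻ s, (eLpNorm (fun y => F (s, y)) (ENNReal.ofReal β) volume) ^ p) ^ (1 / p) := by
  have hq0 : 0 < q := by linarith
  have hp0 : 0 < p := hpq.pos
  have hβ2 : β ≤ 2 := by
    have : 1 / 2 ≤ 1 / β := by rw [hβ]; have : 0 < 1 / (σ * q) := by positivity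
                               linarith
    exact (one_div_le_one_div (by norm_num) hβ0).1 this
  obtain ⟨C, hC, H⟩ := atoms_sum (H := Lp ℂ 2 (volume : Measure V)) hσ hq hpq rfl hγ0 hβ0 hβ2
  refine ⟨C ^ (1 / (2:ℝ)) * (2 * 2 ^ (1 / β)), ?_, ?_⟩
  · refine ENNReal.mul_ne_top (ENNReal.rpow_ne_top_of_nonneg (by norm_num) hC) (ENNReal.mul_ne_top (by norm_num) (ENNReal.rpow_ne_top_of_nonneg (by positivity) (by norm_num)))
  intro F hF
  refine limit_bound hF (fun S => ?_)
  set c : ℤ → ℝ → ℝ≥0∞ := fun k s => 2 * (2:ℝ≥0∞) ^ ((k:ℝ) / β) * lv F k s with hc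
  have h2t : ∀ x y : ℝ, (2:ℝ≥0∞) ^ x * 2 ^ y = 2 ^ (x + y) := fun x y =>
    (ENNReal.rpow_add _ _ (by norm_num) (by norm_num)).symm
  have h1 : ∀ k s, ‖ev (atomF F k) s‖ₑ ≤ ENNReal.ofReal (((2:ℝ)^((k:ℝ)/σ))^(-(1/q))) * c k s := by
    intro k s
    refine ((atomF_dom hF k).ev_enorm_le s).trans ((atomF_L2 hF k s).trans ?_)
    rw [ofReal_two_rpow, hc]
    simp only
    have e : (2:ℝ≥0∞) ^ ((k:ℝ)/σ * -(1/q)) * (2 * 2 ^ ((k:ℝ)/β) * lv F k s)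
      = lv F k s * ((2:ℝ≥0∞) ^ ((k:ℝ)/σ * -(1/q)) * 2 ^ ((k:ℝ)/β) * 2 ^ (1:ℝ)) := by
        rw [ENNReal.rpow_one]; ring
    rw [e, h2t, h2t, dw, ← ENNReal.rpow_mul]
    gcongr
    · norm_num
    · have : (k:ℝ)/β = k * (1/β) := by ring
      rw [this, hβ]
      push_cast
      have : (k:ℝ) / σ * -(1/q) + k * (1/2 + 1/(σ*q)) = k/2 := by field_simp; ring
      linarith
  have h2 : ∀ k s, ∫⁻ x, ‖atomF F k (s, x)‖ₑ ≤ ENNReal.ofReal (((2:ℝ)^((k:ℝ)/σ))^(σ / 2 - 1 / q)) * c k s := by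
    intro k s
    refine (atomF_L1 hF k s).trans (le_of_eq ?_)
    rw [ofReal_two_rpow, hc]
    simp only
    have e : (2:ℝ≥0∞) ^ ((k:ℝ)/σ * (σ / 2 - 1 / q)) * (2 * 2 ^ ((k:ℝ)/β) * lv F k s)
      = lv F k s * ((2:ℝ≥0∞) ^ ((k:ℝ)/σ * (σ / 2 - 1 / q)) * 2 ^ ((k:ℝ)/β) * 2 ^ (1:ℝ)) := by
        rw [ENNReal.rpow_one]; ring
    rw [e, h2t, h2t, dw]
    congr 2
    have : (k:ℝ)/β = k * (1/β) := by ring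
    rw [this, hβ]
    push_cast
    field_simp
    ring
  have h3 := H (fun k => ev (atomF F k)) c (fun k => (atomF_dom hF k).ev_integrable)
    (fun k => (lv_measurable hF.1 k).const_mul _) h1 (by
      intro k l s t hst
      refine ((atomF_dom hF k).ev_inner_enorm (atomF_dom hF l) hst).trans ?_
      rw [hV]
      gcongr
      · exact h2 k s
      · exact h2 l t) S
  have h4 : ∀ s, (∑' k, c k s ^ β) ^ (1 / β) ≤ 2 * 2 ^ (1/β) * eLpNorm (fun y => F (s, y)) (ENNReal.ofReal β) volume := by
    intro s
    have e1 : ∑' k, c k s ^ β ≤ 2 ^ β * (2 * ∫⁻ x, ‖F (s, x)‖ₑ ^ β) := by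
      have : ∀ k, c k s ^ β = 2 ^ β * (dw k * lam volume (fun x => ‖F (s, x)‖ₑ) k ^ β) := by
        intro k
        simp only [hc]
        rw [ENNReal.mul_rpow_of_nonneg _ _ hβ0.le, ENNReal.mul_rpow_of_nonneg _ _ hβ0.le, ← ENNReal.rpow_mul, div_mul_cancel₀ _ hβ0.ne', mul_assoc]
        rfl
      simp_rw [this]
      rw [ENNReal.tsum_mul_left]
      gcongr
      exact lam_sum volume (hF.slice_measurable s).enorm hβ0
    refine (ENNReal.rpow_le_rpow e1 (by positivity)).trans (le_of_eq ?_)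
    rw [eLpNorm_eq_lintegral_rpow_enorm_toReal (by simpa using hβ0) (by simp), ENNReal.toReal_ofReal hβ0.le,
      ENNReal.mul_rpow_of_nonneg _ _ (by positivity), ENNReal.mul_rpow_of_nonneg _ _ (by positivity),
      ← ENNReal.rpow_mul, mul_one_div_cancel hβ0.ne', ENNReal.rpow_one, mul_assoc]
  set K : ℝ≥0∞ := 2 * 2 ^ (1/β) with hK
  have h5 : (∫⁻ s, ((∑' k, c k s ^ β) ^ (1 / β)) ^ p) ^ (1/p) ≤
      K * (∫⁻ s, (eLpNorm (fun y => F (s, y)) (ENNReal.ofReal β) volume) ^ p) ^ (1 / p) := by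
    have e1 : ∫⁻ s, ((∑' k, c k s ^ β) ^ (1 / β)) ^ p ≤
        K ^ p * ∫⁻ s, (eLpNorm (fun y => F (s, y)) (ENNReal.ofReal β) volume) ^ p := by
      rw [← lintegral_const_mul _ ((eLp2_measurable hF.1 (by simpa using hβ0) (by simp)).pow_const _)]
      refine lintegral_mono (fun s => ?_)
      rw [← ENNReal.mul_rpow_of_nonneg _ _ hp0.le]
      exact ENNReal.rpow_le_rpow (h4 s) hp0.le
    refine (ENNReal.rpow_le_rpow e1 (by positivity)).trans (le_of_eq ?_)
    rw [ENNReal.mul_rpow_of_nonneg _ _ (by positivity), ← ENNReal.rpow_mul, mul_one_div_cancel hp0.ne', ENNReal.rpow_one]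
  have h6 := h3.trans (by gcongr : _ ≤ C * (K * (∫⁻ s, (eLpNorm (fun y => F (s, y)) (ENNReal.ofReal β) volume) ^ p) ^ (1 / p)) ^ 2)
  have h7 := ENNReal.rpow_le_rpow h6 (show (0:ℝ) ≤ 1/2 by norm_num)
  have h8 : ∀ x : ℝ≥0∞, (x ^ 2) ^ (1 / (2:ℝ)) = x := fun x => by
    rw [← ENNReal.rpow_natCast, ← ENNReal.rpow_mul]; norm_num
  rw [h8, ENNReal.mul_rpow_of_nonneg _ _ (by norm_num), h8, ← mul_assoc] at h7
  exact h7

lemma energy_case {F : ℝ × V → ℂ} (hF : Dom F) :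
    ‖∫ s, ev F s‖ₑ ≤ ∫⁻ s, eLpNorm (fun y => F (s, y)) 2 volume :=
  (enorm_integral_le_lintegral_enorm _).trans (lintegral_mono fun s => hF.ev_enorm_le s)

end Main

/-- the half-order kernel -/
def hk (τ : ℝ) : ℝ≥0∞ := ENNReal.ofReal (|τ| ^ (-(1 / 2) : ℝ))

lemma hk_measurable : Measurable hk := by unfold hk; fun_prop

lemma hk_even (τ : ℝ) : hk (-τ) = hk τ := by simp [hk]

lemma hk_near {ρ : ℝ} (hρ : 0 < ρ) :
    ∫⁻ τ, (if |τ| ≤ ρ then hk τ else 0) = ENNReal.ofReal (4 * ρ ^ (1 / 2 : ℝ)) := by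
  rw [lintegral_even_tail 0 le_rfl (by
      intro τ h
      have : τ = 0 := abs_eq_zero.1 (le_antisymm h (abs_nonneg _))
      subst this
      simp [hk, Real.zero_rpow]) (by intro τ; simp [hk_even])]
  have h1 : ∫⁻ τ in Set.Ioi 0, (if |τ| ≤ ρ then hk τ else 0) = ∫⁻ τ in Set.Ioc 0 ρ, ENNReal.ofReal (τ ^ (-(1 / 2) : ℝ)) := by
    rw [← lintegral_indicator measurableSet_Ioi, ← lintegral_indicator measurableSet_Ioc]
    congr 1; ext τ
    simp only [Set.indicator_apply, Set.mem_Ioi, Set.mem_Ioc]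
    by_cases h : 0 < τ
    · simp [h, abs_of_pos h, hk]
    · simp [h]
  have hIntble : IntegrableOn (fun τ : ℝ => τ ^ (-(1 / 2) : ℝ)) (Set.Ioc 0 ρ) := by
    have := intervalIntegral.intervalIntegrable_rpow' (a := 0) (b := ρ) (r := -(1/2)) (by norm_num)
    rwa [intervalIntegrable_iff_integrableOn_Ioc_of_le hρ.le] at this
  rw [h1, ← ofReal_integral_eq_lintegral_ofReal hIntble (by
    filter_upwards [ae_restrict_mem measurableSet_Ioc] with τ hτ
    exact Real.rpow_nonneg hτ.1.le _), ← intervalIntegral.integral_of_le hρ.le, integral_rpow (by left; norm_num),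
    show (2 : ℝ≥0∞) = ENNReal.ofReal 2 by simp, ← ENNReal.ofReal_mul (by norm_num)]
  congr 1
  rw [Real.zero_rpow (by norm_num)]
  norm_num
  ring

lemma hk_set {E : Set ℝ} (hE : MeasurableSet E) {ρ : ℝ} (hρ : 0 < ρ) (h : volume E ≤ ENNReal.ofReal ρ) (t : ℝ) :
    ∫⁻ s, E.indicator 1 s * hk (t - s) ≤ ENNReal.ofReal (5 * ρ ^ (1 / 2 : ℝ)) := by
  have h1 : ∀ s, E.indicator 1 s * hk (t - s) ≤ (if |t - s| ≤ ρ then hk (t - s) else 0) +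
      E.indicator (fun _ => ENNReal.ofReal (ρ ^ (-(1/2) : ℝ))) s := by
    intro s
    by_cases hs : s ∈ E
    · simp only [Set.indicator_of_mem hs, Pi.one_apply, one_mul]
      split_ifs with h2
      · exact le_self_add
      · rw [zero_add]
        refine ENNReal.ofReal_le_ofReal (Real.rpow_le_rpow_of_nonpos hρ (not_le.1 h2).le (by norm_num))
    · simp [hs]
  refine (lintegral_mono h1).trans ?_
  have hm : Measurable (fun τ : ℝ => if |τ| ≤ ρ then hk τ else 0) :=
    Measurable.ite (measurableSet_le (by fun_prop) measurable_const) hk_measurable measurable_const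
  rw [lintegral_add_right _ (measurable_const.indicator hE),
    lintegral_sub_left_eq_self (fun τ => if |τ| ≤ ρ then hk τ else 0) t, hk_near hρ,
    lintegral_indicator hE, setLIntegral_const]
  refine (add_le_add_right (mul_le_mul_right h _) _).trans (le_of_eq ?_)
  rw [← ENNReal.ofReal_mul (by positivity), ← ENNReal.ofReal_add (by positivity) (by positivity)]
  congr 1
  have : ρ ^ (-(1/2) : ℝ) * ρ = ρ ^ (1/2 : ℝ) := by
    nth_rewrite 2 [← Real.rpow_one ρ]
    rw [← Real.rpow_add hρ]; norm_num
  rw [this]; ring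

lemma hk_set_dw {E : Set ℝ} (hE : MeasurableSet E) {k : ℤ} (h : volume E ≤ dw k) (t : ℝ) :
    ∫⁻ s, E.indicator 1 s * hk (t - s) ≤ 5 * (2 : ℝ≥0∞) ^ ((k : ℝ) / 2) := by
  have e := ofReal_two_rpow (k : ℝ) 1
  rw [Real.rpow_one, mul_one] at e
  refine (hk_set hE (ρ := (2:ℝ) ^ (k:ℝ)) (by positivity) (by rw [e]; exact h) t).trans (le_of_eq ?_)
  rw [ENNReal.ofReal_mul (by norm_num), ofReal_two_rpow]
  simp [div_eq_mul_inv]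

lemma hk_sets {E G : Set ℝ} (hE : MeasurableSet E) (hG : MeasurableSet G) {k l : ℤ} (h : volume E ≤ dw k)
    (h' : volume G ≤ dw l) :
    ∫⁻ s, ∫⁻ t, E.indicator 1 s * G.indicator 1 t * hk (t - s) ≤ 5 * (2 : ℝ≥0∞) ^ ((k : ℝ) + l / 2) := by
  have h1 : ∀ s, ∫⁻ t, E.indicator 1 s * G.indicator 1 t * hk (t - s) ≤
      E.indicator (fun _ => 5 * (2 : ℝ≥0∞) ^ ((l : ℝ) / 2)) s := by
    intro s
    by_cases hs : s ∈ E
    · simp only [Set.indicator_of_mem hs, Pi.one_apply, one_mul]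
      refine le_trans (le_of_eq ?_) (hk_set_dw hG h' s)
      congr 1; ext t
      rw [← hk_even, neg_sub]
    · simp [hs]
  refine (lintegral_mono h1).trans ?_
  rw [lintegral_indicator hE, setLIntegral_const]
  refine (mul_le_mul_right h _).trans (le_of_eq ?_)
  rw [dw, mul_assoc, ← ENNReal.rpow_add _ _ (by norm_num) (by norm_num), add_comm]

lemma hk_sets' {E G : Set ℝ} (hE : MeasurableSet E) (hG : MeasurableSet G) {k l : ℤ} (h : volume E ≤ dw k)
    (h' : volume G ≤ dw l) :
    ∫⁻ s, ∫⁻ t, E.indicator 1 s * G.indicator 1 t * hk (t - s) ≤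
      5 * ((2 : ℝ≥0∞) ^ (-(1 / 4) : ℝ)) ^ (k - l).natAbs * ((2 : ℝ≥0∞) ^ ((k : ℝ) * (3 / 4)) * (2 : ℝ≥0∞) ^ ((l : ℝ) * (3 / 4))) := by
  have e : 5 * ((2 : ℝ≥0∞) ^ (-(1 / 4) : ℝ)) ^ (k - l).natAbs * ((2 : ℝ≥0∞) ^ ((k : ℝ) * (3 / 4)) * (2 : ℝ≥0∞) ^ ((l : ℝ) * (3 / 4)))
      = 5 * (2 : ℝ≥0∞) ^ (-(1 / 4) * |(k : ℝ) - l| + (k * (3/4) + l * (3/4))) := by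
    rw [ENNReal.rpow_add _ _ (by norm_num) (by norm_num), ENNReal.rpow_add _ _ (by norm_num) (by norm_num),
      ← ENNReal.rpow_natCast, ← ENNReal.rpow_mul, ← mul_assoc, Nat.cast_natAbs]
    push_cast
    ring
  rw [e]
  rcases le_total k l with hkl | hkl
  · have hkl' : (k : ℝ) ≤ l := by exact_mod_cast hkl
    refine (hk_sets hE hG h h').trans (le_of_eq ?_)
    congr 2
    rw [abs_of_nonpos (by linarith)]; ring
  · have hkl' : (l : ℝ) ≤ k := by exact_mod_cast hkl
    have hm : Measurable (Function.uncurry fun s t : ℝ => E.indicator (1 : ℝ → ℝ≥0∞) s * G.indicator 1 t * hk (t - s)) := by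
      refine Measurable.mul (Measurable.mul ?_ ?_) (hk_measurable.comp (by fun_prop))
      · exact (measurable_one.indicator hE).comp measurable_fst
      · exact (measurable_one.indicator hG).comp measurable_snd
    rw [lintegral_lintegral_swap hm.aemeasurable]
    refine le_trans (le_of_eq ?_) ((hk_sets hG hE h' h).trans (le_of_eq ?_))
    · congr 1; ext s; congr 1; ext t
      rw [← hk_even, neg_sub, mul_comm (E.indicator 1 t)]
    · congr 2
      rw [abs_of_nonneg (by linarith)]; ring

section
variable {X : Type*} [MeasurableSpace X]

/-- level annuli -/
def ann (μ : Measure X) (g : X → ℝ≥0∞) (k : ℤ) : Set X := {x | lam μ g (k + 1) < g x ∧ g x ≤ lam μ g k}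

lemma ann_cover (μ : Measure X) {g : X → ℝ≥0∞} (hg : Measurable g) {β : ℝ} (hβ : 0 < β)
    (hfin : ∫⁻ x, g x ^ β ∂μ ≠ ∞) :
    ∀ᵐ x ∂μ, g x ≤ ∑' k, lam μ g k * (ann μ g k).indicator 1 x := by
  filter_upwards [lam_ae_le μ g] with x hx
  rcases eq_or_ne (g x) 0 with h0 | h0
  · rw [h0]; exact zero_le
  obtain ⟨K, hK1, hK2⟩ := (hx.and (lam_eventually_lt μ hg hβ hfin (pos_iff_ne_zero.2 h0))).exists
  have : ∃ k, x ∈ ann μ g k := by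
    have h1 : ∃ n : ℕ, lam μ g (-(K : ℤ) + n) < g x := ⟨2 * K, by
      rw [show (-(K:ℤ) + (2 * K : ℕ)) = K by push_cast; ring]; exact hK2⟩
    classical
    have h2 := Nat.find_spec h1
    have h3 : Nat.find h1 ≠ 0 := by
      intro h
      rw [h] at h2
      simp only [Nat.cast_zero, add_zero] at h2
      exact absurd h2 (not_lt.2 hK1)
    obtain ⟨n, hn⟩ := Nat.exists_eq_succ_of_ne_zero h3
    refine ⟨-(K:ℤ) + n, ?_, ?_⟩
    · rw [hn] at h2; push_cast at h2; rw [add_assoc]; exact h2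
    · exact not_lt.1 (Nat.find_min h1 (m := n) (by omega))
  obtain ⟨k, hk⟩ := this
  refine le_trans ?_ (ENNReal.le_tsum k)
  rw [Set.indicator_of_mem hk]
  simpa using hk.2

lemma ann_meas (μ : Measure X) (g : X → ℝ≥0∞) (k : ℤ) : μ (ann μ g k) ≤ dw (k + 1) :=
  (measure_mono (fun _ hx => hx.1)).trans (lam_meas_le μ g (k + 1))

lemma ann_measurableSet (μ : Measure X) {g : X → ℝ≥0∞} (hg : Measurable g) (k : ℤ) : MeasurableSet (ann μ g k) :=
  (measurableSet_lt measurable_const hg).inter (measurableSet_le hg measurable_const)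
end

lemma hls : ∃ C : ℝ≥0∞, C ≠ ∞ ∧ ∀ g : ℝ → ℝ≥0∞, Measurable g → ∫⁻ s, g s ^ (4 / 3 : ℝ) ≠ ∞ →
    ∫⁻ s, ∫⁻ t, g s * g t * hk (t - s) ≤ C * (∫⁻ s, g s ^ (4 / 3 : ℝ)) ^ (3 / 2 : ℝ) := by
  set θ : ℝ≥0∞ := (2 : ℝ≥0∞) ^ (-(1 / 4) : ℝ) with hθ
  have hθ1 : θ < 1 := ENNReal.rpow_lt_one_of_one_lt_of_neg (by norm_num) (by norm_num)
  set D : ℝ≥0∞ := 5 * ((2 : ℝ≥0∞) ^ (3/4 : ℝ) * 2 ^ (3/4 : ℝ)) with hD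
  have hDt : D ≠ ∞ := by
    refine ENNReal.mul_ne_top (by norm_num) (ENNReal.mul_ne_top ?_ ?_) <;>
    exact ENNReal.rpow_ne_top_of_nonneg (by positivity) (by norm_num)
  refine ⟨D * (2 * (∑' m : ℤ, θ ^ m.natAbs) * 2 ^ (3 / 2 : ℝ)), ?_, ?_⟩
  · refine ENNReal.mul_ne_top hDt (ENNReal.mul_ne_top (ENNReal.mul_ne_top (by norm_num) (tsum_geom_int hθ1)) ?_)
    exact ENNReal.rpow_ne_top_of_nonneg (by positivity) (by norm_num)
  intro g hg hfin
  set A : ℤ → ℝ≥0∞ := fun k => (2 : ℝ≥0∞) ^ ((k : ℝ) * (3 / 4)) * lam volume g k with hA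
  have hcov := ann_cover volume hg (by norm_num : (0:ℝ) < 4/3) hfin
  have hmE := ann_measurableSet volume hg
  have hmi : ∀ k, Measurable ((ann volume g k).indicator (1 : ℝ → ℝ≥0∞)) := fun k => measurable_one.indicator (hmE k)
  have step1 : ∫⁻ s, ∫⁻ t, g s * g t * hk (t - s) ≤ ∑' k, ∑' l, lam volume g k * lam volume g l *
      ∫⁻ s, ∫⁻ t, (ann volume g k).indicator 1 s * (ann volume g l).indicator 1 t * hk (t - s) := by
    have a1 : ∫⁻ s, ∫⁻ t, g s * g t * hk (t - s) ≤ ∫⁻ s, ∫⁻ t, ∑' k, ∑' l, lam volume g k * lam volume g l *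
        ((ann volume g k).indicator 1 s * (ann volume g l).indicator 1 t * hk (t - s)) := by
      refine lintegral_mono_ae ?_
      filter_upwards [hcov] with s hs
      refine lintegral_mono_ae ?_
      filter_upwards [hcov] with t ht
      calc g s * g t * hk (t - s) ≤ (∑' k, lam volume g k * (ann volume g k).indicator 1 s) *
            (∑' l, lam volume g l * (ann volume g l).indicator 1 t) * hk (t - s) := by gcongr
        _ = _ := by
          rw [← ENNReal.tsum_mul_right, ← ENNReal.tsum_mul_right]
          refine tsum_congr (fun k => ?_)
          rw [mul_assoc, ← ENNReal.tsum_mul_right, ← ENNReal.tsum_mul_left]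
          refine tsum_congr (fun l => ?_)
          ring
    refine a1.trans (le_of_eq ?_)
    have hm2 : ∀ k l, Measurable (fun z : ℝ × ℝ => lam volume g k * lam volume g l *
        ((ann volume g k).indicator (1 : ℝ → ℝ≥0∞) z.1 * (ann volume g l).indicator (1 : ℝ → ℝ≥0∞) z.2 * hk (z.2 - z.1))) := by
      intro k l
      refine Measurable.const_mul ?_ _
      exact (((hmi k).comp measurable_fst).mul ((hmi l).comp measurable_snd)).mul (hk_measurable.comp (by fun_prop))
    have hm3 : ∀ k l s, Measurable (fun t : ℝ => lam volume g k * lam volume g l *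
        ((ann volume g k).indicator (1 : ℝ → ℝ≥0∞) s * (ann volume g l).indicator (1 : ℝ → ℝ≥0∞) t * hk (t - s))) :=
      fun k l s => (hm2 k l).comp (measurable_const.prodMk measurable_id)
    have b1 : ∀ s, ∫⁻ t, ∑' k, ∑' l, lam volume g k * lam volume g l *
        ((ann volume g k).indicator 1 s * (ann volume g l).indicator 1 t * hk (t - s)) =
        ∑' k, ∑' l, ∫⁻ t, lam volume g k * lam volume g l *
        ((ann volume g k).indicator 1 s * (ann volume g l).indicator 1 t * hk (t - s)) := by
      intro s
      rw [lintegral_tsum (fun k => (Measurable.ennreal_tsum (fun l => hm3 k l s)).aemeasurable)]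
      refine tsum_congr (fun k => ?_)
      rw [lintegral_tsum (fun l => (hm3 k l s).aemeasurable)]
    simp_rw [b1]
    have hm4 : ∀ k l, Measurable (fun s => ∫⁻ t, lam volume g k * lam volume g l *
        ((ann volume g k).indicator (1 : ℝ → ℝ≥0∞) s * (ann volume g l).indicator (1 : ℝ → ℝ≥0∞) t * hk (t - s))) :=
      fun k l => (hm2 k l).lintegral_prod_right'
    rw [lintegral_tsum (fun k => (Measurable.ennreal_tsum (fun l => hm4 k l)).aemeasurable)]
    refine tsum_congr (fun k => ?_)
    rw [lintegral_tsum (fun l => (hm4 k l).aemeasurable)]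
    refine tsum_congr (fun l => ?_)
    have hm5 : Measurable (fun z : ℝ × ℝ =>
        ((ann volume g k).indicator (1 : ℝ → ℝ≥0∞) z.1 * (ann volume g l).indicator (1 : ℝ → ℝ≥0∞) z.2 * hk (z.2 - z.1))) :=
      (((hmi k).comp measurable_fst).mul ((hmi l).comp measurable_snd)).mul (hk_measurable.comp (by fun_prop))
    rw [← lintegral_const_mul _ hm5.lintegral_prod_right']
    congr 1; ext s
    exact lintegral_const_mul _ (hm5.comp (measurable_const.prodMk measurable_id))
  have step2 : ∑' k, ∑' l, lam volume g k * lam volume g l *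
      ∫⁻ s, ∫⁻ t, (ann volume g k).indicator 1 s * (ann volume g l).indicator 1 t * hk (t - s) ≤
      D * ∑' k, ∑' l, θ ^ (k - l).natAbs * (A k * A l) := by
    rw [← ENNReal.tsum_mul_left]
    refine ENNReal.tsum_le_tsum (fun k => ?_)
    rw [← ENNReal.tsum_mul_left]
    refine ENNReal.tsum_le_tsum (fun l => ?_)
    refine (mul_le_mul_right (hk_sets' (hmE k) (hmE l) (ann_meas _ _ _) (ann_meas _ _ _)) _).trans (le_of_eq ?_)
    rw [show k + 1 - (l + 1) = k - l by ring]
    have e : ∀ k : ℤ, (2 : ℝ≥0∞) ^ (((k + 1 : ℤ) : ℝ) * (3 / 4)) = 2 ^ ((k : ℝ) * (3/4)) * 2 ^ (3/4 : ℝ) := by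
      intro k
      rw [← ENNReal.rpow_add _ _ (by norm_num) (by norm_num)]
      congr 1; push_cast; ring
    rw [e, e]
    simp only [hA, hD]
    ring
  refine step1.trans (step2.trans ?_)
  rw [mul_assoc D]
  refine mul_le_mul_right ?_ D
  refine (schur_tsum θ A).trans ?_
  rw [mul_assoc, mul_assoc, mul_assoc]
  gcongr
  have e2 : ∀ k, A k ^ 2 = (dw k * lam volume g k ^ (4/3 : ℝ)) ^ (3/2 : ℝ) := by
    intro k
    rw [ENNReal.mul_rpow_of_nonneg _ _ (by norm_num), ← ENNReal.rpow_mul, dw, ← ENNReal.rpow_mul]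
    simp only [hA]
    rw [mul_pow, ← ENNReal.rpow_natCast, ← ENNReal.rpow_natCast, ← ENNReal.rpow_mul]
    congr 2 <;> push_cast <;> ring
  simp_rw [e2]
  refine (tsum_rpow_le _ (by norm_num)).trans ?_
  rw [← ENNReal.mul_rpow_of_nonneg _ _ (by norm_num)]
  exact ENNReal.rpow_le_rpow (lam_sum volume hg (by norm_num)) (by norm_num)

section Main
set_option linter.unusedSectionVars false
variable {V : Type*} [NormedAddCommGroup V] [InnerProductSpace ℝ V] [FiniteDimensional ℝ V]
  [MeasurableSpace V] [BorelSpace V]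

lemma one_dim_case (hV : Module.finrank ℝ V = 1) :
    ∃ C : ℝ≥0∞, C ≠ ∞ ∧ ∀ F : ℝ × V → ℂ, Dom F →
      ‖∫ s, ev F s‖ₑ ≤ C * (∫⁻ s, (eLpNorm (fun y => F (s, y)) 1 volume) ^ (4 / 3 : ℝ)) ^ (3 / 4 : ℝ) := by
  obtain ⟨C, hC, H⟩ := hls
  refine ⟨C ^ (1 / (2:ℝ)), ENNReal.rpow_ne_top_of_nonneg (by norm_num) hC, ?_⟩
  intro F hF
  set g : ℝ → ℝ≥0∞ := fun s => eLpNorm (fun y => F (s, y)) 1 volume with hg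
  have hgm : Measurable g := eLp2_measurable hF.1 (by simp) (by simp)
  have hfin : ∫⁻ s, g s ^ (4 / 3 : ℝ) ≠ ∞ := by
    obtain ⟨M, hM, hMb⟩ := hF.eLpNorm_le 1 le_rfl
    have hIntble : ∫⁻ s : ℝ, ENNReal.ofReal (M ^ (4/3 : ℝ) * (1 + s ^ 2)⁻¹) ≠ ∞ :=
      (integrable_inv_one_add_sq.const_mul _).lintegral_lt_top.ne
    refine ne_top_of_le_ne_top hIntble (lintegral_mono (fun s => ?_))
    refine (ENNReal.rpow_le_rpow (hMb s) (by norm_num)).trans ?_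
    rw [ENNReal.ofReal_rpow_of_nonneg (by positivity) (by norm_num)]
    refine ENNReal.ofReal_le_ofReal ?_
    rw [Real.mul_rpow hM (by positivity)]
    gcongr
    refine Real.rpow_le_self_of_le_one (by positivity) (inv_le_one_of_one_le₀ (by nlinarith)) (by norm_num)
  have h1 : ‖∫ s, ev F s‖ₑ ^ 2 ≤ C * (∫⁻ s, g s ^ (4 / 3 : ℝ)) ^ (3 / 2 : ℝ) := by
    refine le_trans ?_ (H g hgm hfin)
    rw [enorm_sq_eq]
    refine (enorm_inner_integral_left _ hF.ev_integrable).trans (lintegral_mono (fun s => ?_))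
    refine (enorm_inner_integral_right _ hF.ev_integrable).trans (lintegral_mono_ae ?_)
    have : ∀ᵐ t : ℝ, t ≠ s := by simp [ae_iff]
    filter_upwards [this] with t hts
    refine (hF.ev_inner_enorm hF hts.symm).trans (le_of_eq ?_)
    rw [hV, mul_comm]
    simp [hg, eLpNorm_one_eq_lintegral_enorm, hk]
  have h7 := ENNReal.rpow_le_rpow h1 (show (0:ℝ) ≤ 1/2 by norm_num)
  have h8 : ∀ x : ℝ≥0∞, (x ^ 2) ^ (1 / (2:ℝ)) = x := fun x => by
    rw [← ENNReal.rpow_natCast, ← ENNReal.rpow_mul]; norm_num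
  rw [h8, ENNReal.mul_rpow_of_nonneg _ _ (by norm_num), ← ENNReal.rpow_mul] at h7
  rw [show (3 / 2 * (1 / 2) : ℝ) = 3 / 4 by norm_num] at h7
  exact h7

end Main

lemma conj_facts {a a' : ℝ≥0∞} (h : 1 / a + 1 / a' = 1) (h2 : 2 ≤ a') :
    a ≠ ∞ ∧ 0 < a.toReal ∧ a = ENNReal.ofReal a.toReal ∧ 1 / a.toReal + (1 / a').toReal = 1 := by
  have h0 : a ≠ 0 := by
    rintro rfl
    simp at h
  have h0' : a' ≠ 0 := by rintro rfl; simp at h2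
  have ht : a ≠ ∞ := by
    rintro rfl
    rw [ENNReal.div_top, zero_add] at h
    have : a' = 1 := by simpa using h
    rw [this] at h2
    norm_num at h2
  refine ⟨ht, ENNReal.toReal_pos h0 ht, (ENNReal.ofReal_toReal ht).symm, ?_⟩
  have := congrArg ENNReal.toReal h
  rw [ENNReal.toReal_add (ENNReal.div_ne_top (by simp) h0) (ENNReal.div_ne_top (by simp) h0'), ENNReal.toReal_div] at this
  simpa using this

lemma core (d : ℕ) (hd : 1 ≤ d) (α β α' β' : ℝ≥0∞)
    (hα : 1 / α + 1 / α' = 1) (hβ : 1 / β + 1 / β' = 1)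
    (hadm : IsAdmissible d α' β') :
    ∃ C : ℝ≥0∞, C ≠ ∞ ∧ ∀ F : ℝ × EuclideanSpace ℝ (Fin d) → ℂ, Dom F →
      ‖∫ s, ev F s‖ₑ ≤ C * (∫⁻ s, (eLpNorm (fun y => F (s, y)) β volume) ^ α.toReal) ^ (1 / α.toReal) := by
  obtain ⟨h2α, h2β, hsc, hne⟩ := hadm
  obtain ⟨hat, ha0, hae, ha⟩ := conj_facts hα h2α
  obtain ⟨hbt, hb0, hbe, hb⟩ := conj_facts hβ h2β
  have hα'0 : α' ≠ 0 := by rintro rfl; simp at h2α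
  have hβ'0 : β' ≠ 0 := by rintro rfl; simp at h2β
  have hd' : (1:ℝ) ≤ d := by exact_mod_cast hd
  have hscR : 2 * (1 / α').toReal + d * (1 / β').toReal = d / 2 := by
    have := congrArg ENNReal.toReal hsc
    rw [ENNReal.toReal_add (ENNReal.div_ne_top (by simp) hα'0) (ENNReal.div_ne_top (by simp) hβ'0), ENNReal.toReal_div,
      ENNReal.toReal_div, ENNReal.toReal_div] at this
    rw [ENNReal.toReal_div, ENNReal.toReal_div]
    simp at this ⊢
    rw [← div_eq_mul_inv, ← div_eq_mul_inv]
    exact this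
  have hfr : Module.finrank ℝ (EuclideanSpace ℝ (Fin d)) = d := by simp
  by_cases hα'1 : α' = ∞
  · rw [hα'1] at ha hscR
    simp only [ENNReal.div_top, ENNReal.toReal_zero, mul_zero, zero_add, add_zero] at ha hscR
    have e1 : α.toReal = 1 := by
      field_simp at ha; exact ha.symm
    have e2 : (1 / β').toReal = 1 / 2 := by
      have : (d:ℝ) * ((1 / β').toReal - 1/2) = 0 := by linarith
      rcases mul_eq_zero.1 this with h | h <;> linarith
    have e3 : β.toReal = 2 := by
      rw [e2] at hb
      have : 1 / β.toReal = 1 / 2 := by linarith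
      field_simp at this; linarith
    have e4 : β = 2 := by rw [hbe, e3]; simp
    refine ⟨1, by simp, fun F hF => ?_⟩
    rw [e1, e4]
    simpa using energy_case hF
  set q := α'.toReal with hq
  have hq2 : 2 ≤ q := by
    have := ENNReal.toReal_mono hα'1 h2α
    simpa using this
  have hq0 : 0 < q := by linarith
  have hqe : (1 / α').toReal = 1 / q := by rw [ENNReal.toReal_div]; simp [hq]
  rw [hqe] at ha hscR
  by_cases hβ'1 : β' = ∞
  · rw [hβ'1] at hb hscR
    simp only [ENNReal.div_top, ENNReal.toReal_zero, mul_zero, add_zero] at hb hscR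
    have e1 : β.toReal = 1 := by
      field_simp at hb; exact hb.symm
    have e4 : β = 1 := by rw [hbe, e1]; simp
    have hqd : (d:ℝ) * q = 4 := by field_simp at hscR; linarith
    have hd2 : (d:ℝ) ≤ 2 := by nlinarith
    have hd2' : d ≤ 2 := by exact_mod_cast hd2
    have hd1 : d = 1 := by
      by_contra hcon
      have hdd : d = 2 := by omega
      apply hne
      refine ⟨hdd, ?_, hβ'1⟩
      rw [hdd] at hqd
      have : q = 2 := by push_cast at hqd; linarith
      rw [← ENNReal.ofReal_toReal hα'1, ← hq, this]; simp
    subst hd1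
    have hq4 : q = 4 := by push_cast at hqd; linarith
    have e5 : α.toReal = 4 / 3 := by
      rw [hq4] at ha
      have : 1 / α.toReal = 3 / 4 := by linarith
      field_simp at this; linarith
    obtain ⟨C, hC, H⟩ := one_dim_case (V := EuclideanSpace ℝ (Fin 1)) hfr
    refine ⟨C, hC, fun F hF => ?_⟩
    rw [e5, e4, show (1 / (4 / 3) : ℝ) = 3 / 4 by norm_num]
    exact H F hF
  set r := β'.toReal with hr
  have hr2 : 2 ≤ r := by
    have := ENNReal.toReal_mono hβ'1 h2β
    simpa using this
  have hr0 : 0 < r := by linarith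
  have hre : (1 / β').toReal = 1 / r := by rw [ENNReal.toReal_div]; simp [hr]
  rw [hre] at hb hscR
  have hpq : α.toReal.HolderConjugate q := by
    rw [Real.holderConjugate_iff]
    refine ⟨?_, by simpa using ha⟩
    have hpos : 0 < 1 / q := by positivity
    have : 1 / α.toReal < 1 := by linarith
    rwa [div_lt_one ha0] at this
  have hb' : 1 / β.toReal = 1 / 2 + 1 / ((d:ℝ) / 2 * q) := by
    have : 1 / r = 1/2 - 1 / ((d:ℝ) / 2 * q) := by
      have h1 : (1:ℝ) / r = (d * (1 / r)) / d := by field_simp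
      have h2 : (d:ℝ) * (1 / r) = d / 2 - 2 * (1 / q) := by linarith
      rw [h1, h2]; field_simp
    linarith
  have hg : 0 < (d:ℝ) / 2 / 2 - 1 / q := by
    have : 0 < (d:ℝ) * (1 / r) := by positivity
    linarith
  obtain ⟨C, hC, H⟩ := main_case (V := EuclideanSpace ℝ (Fin d)) (σ := (d:ℝ) / 2) (by rw [hfr]) (by positivity) hq2 hpq hb0 hb' hg
  refine ⟨C, hC, fun F hF => ?_⟩
  have := H F hF
  rwa [← hbe] at this

/-- **Dual (inhomogeneous endpoint) Strichartz estimate.** For `d ≥ 1` and a dual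
admissible pair `(α,β)` (i.e. the Hölder conjugates `(α',β')` form an admissible pair),
there is `C > 0` such that for all Schwartz `F : ℝ × ℝ^d → ℂ`,
`‖∫_ℝ e^{-isΔ}F(s,·) ds‖_{L²} ≤ C ‖F‖_{L^α_t L^β_x}`. -/
theorem strichartz_dual (d : ℕ) (hd : 1 ≤ d) (α β α' β' : ℝ≥0∞)
    (hα : 1 / α + 1 / α' = 1) (hβ : 1 / β + 1 / β' = 1)
    (hadm : IsAdmissible d α' β') :
    ∃ C > (0 : ℝ), ∀ F : SchwartzMap (ℝ × EuclideanSpace ℝ (Fin d)) ℂ,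
      eLpNorm
          (fun x : EuclideanSpace ℝ (Fin d) =>
            ∫ s : ℝ, schrod d (-s) (fun y => F (s, y)) x) 2 volume ≤
        ENNReal.ofReal C *
          mixedLNorm α (fun s : ℝ => eLpNorm (fun y => F (s, y)) β volume) := by
  obtain ⟨C, hC, H⟩ := core d hd α β α' β' hα hβ hadm
  have hat := (conj_facts hα hadm.1).1
  refine ⟨C.toReal + 1, by positivity, fun F => ?_⟩
  refine (lhs_le F).trans ?_
  rw [ev_integral_coe F]
  refine (H F (dom_schwartz F)).trans ?_
  rw [mixedLNorm, if_neg hat]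
  gcongr
  rw [← ENNReal.ofReal_toReal hC]
  refine ENNReal.ofReal_le_ofReal ?_
  rw [ENNReal.toReal_ofReal ENNReal.toReal_nonneg]
  linarith
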